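/- arXiv:2201.07550 — 5 statements merged into one kernel-verified Lean document; each statement's English description precedes it below -/
import Mathlib

section
/- Let K be an algebraically closed field of characteristic 0, S = K[x₀,…,x_n], d ≥ 3, and let I = (f₀,…,f_n) ⊆ S where f₀,…,f_n is a regular sequence of homogeneous polynomials of degree d−1. Set R = S/I and N = (d−2)(n+1). Then for every h with 1 ≤ h ≤ N−1 and every nonzero η ∈ R^h, one has h ≥ (d−2)·dim_K ker(·η : R¹ → R^{1+h}). -/
/-- The degree-`i` graded piece of the quotient `R = S/I` of a polynomial ring by a
homogeneous ideal: the image of the homogeneous polynomials of degree `i` under the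
quotient map. -/
noncomputable def gradedPiece {K : Type*} [Field K] {n : ℕ}
    (I : Ideal (MvPolynomial (Fin n) K)) (i : ℕ) :
    Submodule K (MvPolynomial (Fin n) K ⧸ I) :=
  (MvPolynomial.homogeneousSubmodule (Fin n) K i).map (Ideal.Quotient.mkₐ K I).toLinearMap

/-- If each of finitely many quotients `S ⧸ J i` admits a regular element lying in the radical of the
ideal generated by a subspace `W`, then some element of `W` is regular on all of them. -/
theorem exists_mem_isSMulRegular_quotient {K S : Type*} [Field K] [Infinite K] [CommRing S]
    [IsNoetherianRing S] [Algebra K S] (W : Submodule K S) {ι : Type*} [Finite ι] (J : ι → Ideal S)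
    (hJ : ∀ i, ∃ y ∈ (Ideal.span (W : Set S)).radical, IsSMulRegular (S ⧸ J i) y) :
    ∃ w ∈ W, ∀ i, IsSMulRegular (S ⧸ J i) w := by
  have key (i : ι) (P : Ideal S) (hP : P ∈ associatedPrimes S (S ⧸ J i)) :
      (P.restrictScalars K).comap W.subtype ≠ ⊤ := by
    intro htop
    obtain ⟨y, hy, hreg⟩ := hJ i
    have hW : Ideal.span (W : Set S) ≤ P := by
      rw [Ideal.span_le]
      intro w hw
      have : (⟨w, hw⟩ : W) ∈ (P.restrictScalars K).comap W.subtype := htop ▸ Submodule.mem_top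
      simpa using this
    have hyP : y ∈ P := hP.isPrime.radical_le_iff.mpr hW hy
    have : y ∈ ⋃ p ∈ associatedPrimes S (S ⧸ J i), (p : Set S) := Set.mem_biUnion hP hyP
    rw [biUnion_associatedPrimes_eq_compl_regular] at this
    exact this hreg
  have (i : ι) : Finite (associatedPrimes S (S ⧸ J i)) := (associatedPrimes.finite S _).to_subtype
  by_contra! hcon
  obtain ⟨⟨i, P⟩, hP⟩ := Subspace.exists_eq_top_of_iUnion_eq_univ (k := K) (E := W)
    (p := fun q : Σ i, associatedPrimes S (S ⧸ J i) ↦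
      ((q.2 : Ideal S).restrictScalars K).comap W.subtype) (by
        refine Set.eq_univ_of_forall fun w ↦ ?_
        obtain ⟨i, hi⟩ := hcon w w.2
        have : (w : S) ∈ {r : S | IsSMulRegular (S ⧸ J i) r}ᶜ := hi
        rw [← biUnion_associatedPrimes_eq_compl_regular] at this
        obtain ⟨P, hP, hw⟩ := Set.mem_iUnion₂.mp this
        exact Set.mem_iUnion.mpr ⟨⟨i, P, hP⟩, hw⟩)
  exact key i P P.2 hP

theorem IsSMulRegular.quotient_sup_span_swap {S : Type*} [CommRing S] {J : Ideal S} {y g : S}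
    (hy : IsSMulRegular (S ⧸ J) y) (hg : IsSMulRegular (S ⧸ (J ⊔ Ideal.span {y})) g) :
    IsSMulRegular (S ⧸ (J ⊔ Ideal.span {g})) y := by
  rw [isSMulRegular_quotient_iff_mem_of_smul_mem] at *
  intro x hx
  simp only [smul_eq_mul] at *
  obtain ⟨r, hr, t, ht, hc⟩ := Submodule.mem_sup.mp hx
  obtain ⟨c, rfl⟩ := Ideal.mem_span_singleton'.mp ht
  have hcy : c ∈ J ⊔ Ideal.span {y} := by
    refine hg c ?_
    rw [show g * c = y * x - r by rw [← hc]; ring]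
    exact sub_mem (Ideal.mul_mem_right _ _ (Ideal.mem_sup_right (Ideal.mem_span_singleton_self y)))
      (Ideal.mem_sup_left hr)
  obtain ⟨r', hr', s, hs, h⟩ := Submodule.mem_sup.mp hcy
  obtain ⟨b, rfl⟩ := Ideal.mem_span_singleton'.mp hs
  have : x - b * g ∈ J := by
    refine hy _ ?_
    rw [show y * (x - b * g) = r + r' * g by linear_combination -hc - g * h]
    exact add_mem hr (Ideal.mul_mem_right _ _ hr')
  rw [show x = (x - b * g) + b * g by ring]
  exact add_mem (Ideal.mem_sup_left this)
    (Ideal.mem_sup_right (Ideal.mul_mem_left _ _ (Ideal.mem_span_singleton_self g)))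

attribute [local instance] MvPolynomial.gradedAlgebra in
/-- If `y` and `g` are both regular modulo `J`, a class in `S ⧸ (J, g)` killed by `y` yields a class
in `S ⧸ (J, y)` with at least the same annihilator, of degree lower by `deg g - deg y`. -/
theorem exists_isHomogeneous_swap {K σ : Type*} [Field K] {J : Ideal (MvPolynomial σ K)}
    (hJ : J.IsHomogeneous (MvPolynomial.homogeneousSubmodule σ K))
    {y g η : MvPolynomial σ K} {D h : ℕ}
    (hyh : y.IsHomogeneous 1) (hgh : g.IsHomogeneous D) (hηh : η.IsHomogeneous h)
    (hy : IsSMulRegular (MvPolynomial σ K ⧸ J) y) (hg : IsSMulRegular (MvPolynomial σ K ⧸ J) g)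
    (hη : η ∉ J ⊔ Ideal.span {g}) (hyη : y * η ∈ J ⊔ Ideal.span {g}) :
    ∃ (η' : MvPolynomial σ K) (e : ℕ), η'.IsHomogeneous e ∧ e + D = h + 1 ∧
      η' ∉ J ⊔ Ideal.span {y} ∧
      ∀ z, z * η ∈ J ⊔ Ideal.span {g} → z * η' ∈ J ⊔ Ideal.span {y} := by
  rw [isSMulRegular_quotient_iff_mem_of_smul_mem] at hy hg
  simp only [smul_eq_mul] at hy hg
  obtain ⟨r, hr, s, hs, hrs⟩ := Submodule.mem_sup.mp hyη
  obtain ⟨c, rfl⟩ := Ideal.mem_span_singleton'.mp hs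
  obtain ⟨η', e, hη'h, he, hη'⟩ : ∃ (η' : MvPolynomial σ K) (e : ℕ), η'.IsHomogeneous e ∧
      e + D = h + 1 ∧ y * η - η' * g ∈ J := by
    have hcomp : y * η - MvPolynomial.homogeneousComponent (h + 1) (c * g) ∈ J := by
      have := MvPolynomial.homogeneousComponent_mem_of_mem hJ hr (h + 1)
      rwa [eq_sub_of_add_eq hrs, map_sub, MvPolynomial.homogeneousComponent_eq_self
        (add_comm 1 h ▸ hyh.mul hηh)] at this
    have hsum : c * g = ∑ i ∈ Finset.range (c.totalDegree + 1),
        MvPolynomial.homogeneousComponent i c * g := by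
      rw [← Finset.sum_mul, MvPolynomial.sum_homogeneousComponent]
    have hprod (i : ℕ) := (MvPolynomial.homogeneousComponent_isHomogeneous i c).mul hgh
    by_cases hD : D ≤ h + 1
    · refine ⟨MvPolynomial.homogeneousComponent (h + 1 - D) c, h + 1 - D,
        MvPolynomial.homogeneousComponent_isHomogeneous _ _, by omega, ?_⟩
      convert hcomp using 2
      rw [hsum, map_sum, Finset.sum_congr rfl fun i _ ↦
        MvPolynomial.homogeneousComponent_of_mem (hprod i)]
      rw [Finset.sum_eq_single (h + 1 - D), if_pos (by omega)]
      · intro i _ hi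
        rw [if_neg (by omega)]
      · intro hi
        rw [MvPolynomial.homogeneousComponent_eq_zero _ _ (by rw [Finset.mem_range] at hi; omega)]
        simp
    · exfalso
      have h0 : MvPolynomial.homogeneousComponent (h + 1) (c * g) = 0 := by
        rw [hsum, map_sum]
        refine Finset.sum_eq_zero fun i _ ↦ ?_
        rw [MvPolynomial.homogeneousComponent_of_mem (hprod i), if_neg (by omega)]
      rw [h0, sub_zero] at hcomp
      exact hη (Ideal.mem_sup_left (hy _ hcomp))
  refine ⟨η', e, hη'h, he, fun hmem ↦ hη ?_, fun z hz ↦ ?_⟩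
  · obtain ⟨r', hr', s', hs', h'⟩ := Submodule.mem_sup.mp hmem
    obtain ⟨b, rfl⟩ := Ideal.mem_span_singleton'.mp hs'
    have : η - b * g ∈ J := by
      refine hy _ ?_
      rw [show y * (η - b * g) = (y * η - η' * g) + r' * g by linear_combination -g * h']
      exact add_mem hη' (Ideal.mul_mem_right _ _ hr')
    rw [show η = (η - b * g) + b * g by ring]
    exact add_mem (Ideal.mem_sup_left this)
      (Ideal.mem_sup_right (Ideal.mul_mem_left _ _ (Ideal.mem_span_singleton_self g)))
  · obtain ⟨r', hr', s', hs', h'⟩ := Submodule.mem_sup.mp hz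
    obtain ⟨b, rfl⟩ := Ideal.mem_span_singleton'.mp hs'
    have : z * η' - b * y ∈ J := by
      refine hg _ ?_
      rw [show g * (z * η' - b * y) = y * r' - z * (y * η - η' * g) by
        linear_combination -y * h']
      exact sub_mem (Ideal.mul_mem_left _ _ hr') (Ideal.mul_mem_left _ _ hη')
    rw [show z * η' = (z * η' - b * y) + b * y by ring]
    exact add_mem (Ideal.mem_sup_left this)
      (Ideal.mem_sup_right (Ideal.mul_mem_left _ _ (Ideal.mem_span_singleton_self y)))

theorem Set.image_Iio_add_one {α : Type*} (y : ℕ → α) (j : ℕ) :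
    y '' Set.Iio (j + 1) = insert (y j) (y '' Set.Iio j) := by
  rw [← Order.succ_eq_add_one, Order.Iio_succ_eq_insert, Set.image_insert_eq]

theorem Ideal.span_image_Iio_add_one {S : Type*} [CommSemiring S] (y : ℕ → S) (j : ℕ) :
    Ideal.span (y '' Set.Iio (j + 1)) = Ideal.span (y '' Set.Iio j) ⊔ Ideal.span {y j} := by
  rw [Set.image_Iio_add_one, Ideal.span_insert, sup_comm]

theorem exists_generic_ideal_sequence {K S : Type*} [Field K] [Infinite K] [CommRing S]
    [IsNoetherianRing S] [Algebra K S] (W : Submodule K S) (n : ℕ) (y : ℕ → S)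
    (hyW : ∀ j ≤ n, y j ∈ (Ideal.span (W : Set S)).radical)
    (hy : ∀ j ≤ n, IsSMulRegular (S ⧸ Ideal.span (y '' Set.Iio j)) (y j)) :
    ∃ g : ℕ → S, (∀ l, g l ∈ W) ∧ ∀ j l, j + l ≤ n →
      IsSMulRegular (S ⧸ (Ideal.span (y '' Set.Iio j) ⊔ Ideal.span (g '' Set.Iio l))) (y j) ∧
      IsSMulRegular (S ⧸ (Ideal.span (y '' Set.Iio j) ⊔ Ideal.span (g '' Set.Iio l))) (g l) := by
  have step (l : ℕ) (G : Ideal S) : ∃ w ∈ W, (∀ j, j + l ≤ n →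
      IsSMulRegular (S ⧸ (Ideal.span (y '' Set.Iio j) ⊔ G)) (y j)) →
      ∀ j, j + l ≤ n → IsSMulRegular (S ⧸ (Ideal.span (y '' Set.Iio j) ⊔ G)) w := by
    by_cases hG : ∀ j, j + l ≤ n → IsSMulRegular (S ⧸ (Ideal.span (y '' Set.Iio j) ⊔ G)) (y j)
    · obtain ⟨w, hw, h⟩ := exists_mem_isSMulRegular_quotient W
        (fun j : Fin (n + 1 - l) ↦ Ideal.span (y '' Set.Iio j.val) ⊔ G)
        fun j ↦ ⟨y j, hyW j (by omega), hG j (by omega)⟩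
      exact ⟨w, hw, fun _ j hj ↦ h ⟨j, by omega⟩⟩
    · exact ⟨0, W.zero_mem, fun h ↦ absurd h hG⟩
  choose c hcW hc using step
  let G : ℕ → Ideal S := fun l ↦ Nat.rec ⊥ (fun l J ↦ J ⊔ Ideal.span {c l J}) l
  have hG (l : ℕ) : G l = Ideal.span ((fun l ↦ c l (G l)) '' Set.Iio l) := by
    induction l with
    | zero => simp [G]
    | succ l ih =>
      rw [Ideal.span_image_Iio_add_one, ← ih]
  have hinv (l : ℕ) : ∀ j, j + l ≤ n →
      IsSMulRegular (S ⧸ (Ideal.span (y '' Set.Iio j) ⊔ G l)) (y j) := by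
    induction l with
    | zero =>
      intro j hj
      rw [show G 0 = ⊥ from rfl, sup_bot_eq]
      exact hy j hj
    | succ l ih =>
      intro j hj
      change IsSMulRegular (S ⧸ (_ ⊔ (G l ⊔ Ideal.span {c l (G l)}))) _
      rw [← sup_assoc]
      refine (ih j (by omega)).quotient_sup_span_swap ?_
      have := hc l (G l) ih (j + 1) (by omega)
      rwa [Ideal.span_image_Iio_add_one, sup_right_comm] at this
  refine ⟨fun l ↦ c l (G l), fun l ↦ hcW _ _, fun j l hjl ↦ ?_⟩
  rw [← hG]
  exact ⟨hinv l j hjl, hc l (G l) (hinv l) j hjl⟩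

attribute [local instance] MvPolynomial.gradedAlgebra in
/-- A form outside the ideal of `n + 1` forms of degree `D` that is multiplied into that ideal by the
first `k` of a regular sequence of linear forms has degree at least `(D - 1) * k`. -/
theorem mul_pred_le_of_mul_mem_span {K : Type*} [Field K] [Infinite K] {σ : Type*} [Finite σ]
    {n D : ℕ} (hD : 1 ≤ D) (f : Fin (n + 1) → MvPolynomial σ K)
    (hf : ∀ i, (f i).IsHomogeneous D) (y : ℕ → MvPolynomial σ K)
    (hyh : ∀ j, (y j).IsHomogeneous 1)
    (hyf : ∀ j ≤ n, y j ∈ (Ideal.span (Set.range f)).radical)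
    (hy : ∀ j ≤ n, IsSMulRegular (MvPolynomial σ K ⧸ Ideal.span (y '' Set.Iio j)) (y j))
    {h k : ℕ} (hk : k ≤ n + 1) {η : MvPolynomial σ K} (hηh : η.IsHomogeneous h)
    (hη : η ∉ Ideal.span (Set.range f))
    (hyη : ∀ j < k, y j * η ∈ Ideal.span (Set.range f)) :
    (D - 1) * k ≤ h := by
  set W : Submodule K (MvPolynomial σ K) := Submodule.span K (Set.range f) with hW
  have hWf : Ideal.span (W : Set (MvPolynomial σ K)) = Ideal.span (Set.range f) := by
    apply Submodule.span_span_of_tower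
  have hWh : W ≤ MvPolynomial.homogeneousSubmodule σ K D := by
    rw [hW, Submodule.span_le]
    rintro _ ⟨i, rfl⟩
    exact hf i
  obtain ⟨g, hgW, hreg⟩ := exists_generic_ideal_sequence W n y (by rwa [hWf]) hy
  have hgh (l : ℕ) : (g l).IsHomogeneous D := hWh (hgW l)
  have hgG (l : ℕ) (hl : l ≤ n) : g l ∉ Ideal.span (g '' Set.Iio l) := by
    intro hmem
    have h1 := (hreg 0 l (by omega)).2
    rw [isSMulRegular_quotient_iff_mem_of_smul_mem] at h1
    have h2 := h1 1 (by simpa using hmem)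
    have h3 : Ideal.span (y '' Set.Iio 0) ⊔ Ideal.span (g '' Set.Iio l) ≤
        RingHom.ker (MvPolynomial.constantCoeff (R := K) (σ := σ)) := by
      rw [show Set.Iio 0 = (∅ : Set ℕ) from Set.Iio_bot, Set.image_empty, Ideal.span_empty,
        bot_sup_eq, Ideal.span_le]
      rintro _ ⟨i, _, rfl⟩
      refine (hgh i).coeff_eq_zero (d := 0) ?_
      simp only [map_zero]
      omega
    simpa using h3 h2
  have hrank (l : ℕ) (hl : l ≤ n + 1) :
      l ≤ Module.finrank K (Submodule.span K (g '' Set.Iio l)) := by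
    induction l with
    | zero => simp
    | succ l ih =>
      have : FiniteDimensional K (Submodule.span K (g '' Set.Iio (l + 1))) :=
        FiniteDimensional.span_of_finite K ((Set.finite_Iio _).image g)
      refine Nat.succ_le_of_lt ((ih (by omega)).trans_lt (Submodule.finrank_lt_finrank_of_lt ?_))
      rw [Set.image_Iio_add_one]
      refine lt_of_le_not_ge (Submodule.span_mono (Set.subset_insert _ _)) fun hle ↦ ?_
      exact hgG l (by omega) (Submodule.span_subset_span K _ _
        (hle (Submodule.subset_span (Set.mem_insert _ _))))
  have hWspan : Submodule.span K (g '' Set.Iio (n + 1)) = W := by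
    have : FiniteDimensional K W := FiniteDimensional.span_of_finite K (Set.finite_range f)
    refine Submodule.eq_of_le_of_finrank_le (Submodule.span_le.mpr ?_) ?_
    · rintro _ ⟨i, _, rfl⟩
      exact hgW i
    · refine le_trans ?_ (hrank _ le_rfl)
      exact (finrank_range_le_card (R := K) f).trans (by simp)
  have hG : Ideal.span (g '' Set.Iio (n + 1)) = Ideal.span (Set.range f) := by
    rw [← hWf, ← hWspan]
    exact (Submodule.span_span_of_tower ..).symm
  have hhom (i l : ℕ) : (Ideal.span (y '' Set.Iio i) ⊔ Ideal.span (g '' Set.Iio l)).IsHomogeneous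
      (MvPolynomial.homogeneousSubmodule σ K) := by
    refine Ideal.IsHomogeneous.sup (Ideal.homogeneous_span _ _ ?_) (Ideal.homogeneous_span _ _ ?_)
    · rintro _ ⟨j, _, rfl⟩
      exact ⟨1, hyh j⟩
    · rintro _ ⟨j, _, rfl⟩
      exact ⟨D, hgh j⟩
  have main (i : ℕ) (hi : i ≤ k) : ∃ (η' : MvPolynomial σ K) (e : ℕ), η'.IsHomogeneous e ∧
      e + (D - 1) * i = h ∧
      η' ∉ Ideal.span (y '' Set.Iio i) ⊔ Ideal.span (g '' Set.Iio (n + 1 - i)) ∧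
      ∀ j < k, y j * η' ∈
        Ideal.span (y '' Set.Iio i) ⊔ Ideal.span (g '' Set.Iio (n + 1 - i)) := by
    induction i with
    | zero => exact ⟨η, h, hηh, by simp, by simpa [hG] using hη, by simpa [hG] using hyη⟩
    | succ i ih =>
      obtain ⟨η₀, e₀, hη₀h, he₀, hη₀, hyη₀⟩ := ih (by omega)
      obtain ⟨hyr, hgr⟩ := hreg i (n - i) (by omega)
      rw [show n + 1 - i = (n - i) + 1 by omega, Ideal.span_image_Iio_add_one, ← sup_assoc] at hη₀ hyη₀
      obtain ⟨η', e, hη'h, he, hη', hyη'⟩ := exists_isHomogeneous_swap (hhom i (n - i)) (hyh i)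
        (hgh (n - i)) hη₀h hyr hgr hη₀ (hyη₀ i (by omega))
      refine ⟨η', e, hη'h, by rw [mul_add]; omega, ?_⟩
      rw [show n + 1 - (i + 1) = n - i by omega, Ideal.span_image_Iio_add_one, sup_right_comm]
      exact ⟨hη', fun j hj ↦ hyη' _ (hyη₀ j hj)⟩
  obtain ⟨_, e, _, he, _⟩ := main k le_rfl
  omega

theorem Module.supportDim_quotient_add_length_le {R : Type*} [CommRing R] [IsNoetherianRing R]
    {M : Type*} [AddCommGroup M] [Module R M] [Module.Finite R M] (rs : List R)
    (hrs : RingTheory.Sequence.IsWeaklyRegular M rs) :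
    Module.supportDim R (M ⧸ Ideal.ofList rs • (⊤ : Submodule R M)) + rs.length ≤
      Module.supportDim R M := by
  induction rs generalizing M with
  | nil =>
    rw [Ideal.ofList_nil, Submodule.bot_smul]
    simpa using (Module.supportDim_eq_of_equiv (Submodule.quotEquivOfEqBot ⊥ rfl)).le
  | cons x rs' ih =>
    obtain ⟨h₁, h₂⟩ := (RingTheory.Sequence.isWeaklyRegular_cons_iff M _ _).mp hrs
    have h₃ := Module.supportDim_quotSMulTop_succ_le_of_notMem_minimalPrimes
      (fun _ ↦ h₁.notMem_of_mem_minimalPrimes)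
    rw [Module.supportDim_eq_of_equiv (Submodule.quotOfListConsSMulTopEquivQuotSMulTopInner M x _)]
    refine le_trans ?_ h₃
    rw [List.length_cons, Nat.cast_add, Nat.cast_one, ← add_assoc]
    gcongr
    exact ih h₂

attribute [local instance] MvPolynomial.gradedAlgebra in
theorem X_mem_radical_of_isRegular {K : Type*} [Field K] {n D : ℕ}
    (f : Fin n → MvPolynomial (Fin n) K)
    (hf : ∀ i, (f i).IsHomogeneous D)
    (hreg : RingTheory.Sequence.IsRegular (MvPolynomial (Fin n) K) (List.ofFn f)) (i : Fin n) :
    MvPolynomial.X i ∈ (Ideal.span (Set.range f)).radical := by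
  set I := Ideal.span (Set.range f) with hI
  have hIl : Ideal.ofList (List.ofFn f) = I := by
    rw [hI, Ideal.ofList]; congr 1; ext; simp [List.mem_ofFn]
  have hIh : I.IsHomogeneous (MvPolynomial.homogeneousSubmodule (Fin n) K) := by
    refine Ideal.homogeneous_span _ _ ?_
    rintro _ ⟨j, rfl⟩
    exact ⟨D, hf j⟩
  have hdim := Module.supportDim_quotient_add_length_le _ hreg.toIsWeaklyRegular
  have hdim0 : ringKrullDim (MvPolynomial (Fin n) K ⧸ I) ≤ 0 := by
    rw [smul_eq_mul, Ideal.mul_top, hIl, Module.supportDim_quotient_eq_ringKrullDim,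
      Module.supportDim_self_eq_ringKrullDim, MvPolynomial.ringKrullDim_of_isNoetherianRing,
      ringKrullDim_eq_zero_of_field, List.length_ofFn, Nat.card_eq_fintype_card,
      Fintype.card_fin, zero_add] at hdim
    generalize ringKrullDim (MvPolynomial (Fin n) K ⧸ I) = t at *
    induction t with
    | bot => simp
    | coe t =>
      induction t with
      | top =>
        exfalso
        have : ((⊤ : ℕ∞) + (n : ℕ∞) : ℕ∞) ≤ (n : ℕ∞) := by exact_mod_cast hdim
        simp at this
      | coe t =>
        have : t + n ≤ n := by exact_mod_cast hdim
        have : t = 0 := by omega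
        subst this; simp
  have hkd : Ring.KrullDimLE 0 (MvPolynomial (Fin n) K ⧸ I) := by
    rw [Ring.KrullDimLE, Order.krullDimLE_iff]; exact_mod_cast hdim0
  have hfin : Module.Finite K (MvPolynomial (Fin n) K ⧸ I) :=
    (Module.finite_iff_krullDimLE_zero K _).mpr hkd
  have hint : IsIntegral K (Ideal.Quotient.mkₐ K I (MvPolynomial.X i)) :=
    Algebra.IsIntegral.isIntegral _
  obtain ⟨p, hp, hp0⟩ := hint
  rw [← Polynomial.aeval_def, Polynomial.aeval_algHom_apply, Ideal.Quotient.mkₐ_eq_mk,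
    Ideal.Quotient.eq_zero_iff_mem] at hp0
  refine ⟨p.natDegree, ?_⟩
  have := MvPolynomial.homogeneousComponent_mem_of_mem hIh hp0 p.natDegree
  rw [Polynomial.aeval_eq_sum_range, map_sum, Finset.sum_eq_single p.natDegree] at this
  · rwa [hp.coeff_natDegree, one_smul, MvPolynomial.homogeneousComponent_eq_self
      (MvPolynomial.isHomogeneous_X_pow i _)] at this
  · intro b _ hb
    rw [map_smul, MvPolynomial.homogeneousComponent_of_mem (MvPolynomial.isHomogeneous_X_pow i b),
      if_neg hb.symm, smul_zero]
  · simp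

theorem MvPolynomial.isSMulRegular_quotient_span_X_image {K σ : Type*} [Field K] {s : Set σ}
    {j : σ} (hj : j ∉ s) :
    IsSMulRegular (MvPolynomial σ K ⧸
      Ideal.span (MvPolynomial.X '' s : Set (MvPolynomial σ K))) (MvPolynomial.X j : MvPolynomial σ K) := by
  classical
  rw [isSMulRegular_quotient_iff_mem_of_smul_mem]
  intro p hp
  rw [smul_eq_mul, mul_comm] at hp
  rw [MvPolynomial.mem_ideal_span_X_image] at hp ⊢
  intro m hm
  obtain ⟨i, hi, hne⟩ := hp (m + Finsupp.single j 1) (by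
    rw [MvPolynomial.mem_support_iff, MvPolynomial.coeff_mul_X]
    exact MvPolynomial.mem_support_iff.mp hm)
  have hij : j ≠ i := fun h ↦ hj (h ▸ hi)
  exact ⟨i, hi, by simpa [Finsupp.single_eq_of_ne hij.symm] using hne⟩

/-- The linear form with a given coefficient vector. -/
noncomputable def MvPolynomial.linearForm (K σ : Type*) [Field K] [Fintype σ] :
    (σ → K) →ₗ[K] MvPolynomial σ K :=
  Fintype.linearCombination K MvPolynomial.X

theorem MvPolynomial.linearForm_apply {K σ : Type*} [Field K] [Fintype σ] (a : σ → K) :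
    linearForm K σ a = ∑ i, a i • MvPolynomial.X i := rfl

theorem MvPolynomial.range_linearForm (K σ : Type*) [Field K] [Fintype σ] :
    LinearMap.range (linearForm K σ) = homogeneousSubmodule σ K 1 := by
  rw [homogeneousSubmodule_one_eq_span_X, linearForm, Fintype.range_linearCombination]

theorem MvPolynomial.isSMulRegular_quotient_span_linearForm_image {K σ : Type*} [Field K]
    [Fintype σ] (b : Module.Basis σ K (σ → K)) {s : Set σ} {j : σ} (hj : j ∉ s) :
    IsSMulRegular (MvPolynomial σ K ⧸ Ideal.span ((fun i ↦ linearForm K σ (b i)) '' s))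
      (linearForm K σ (b j)) := by
  classical
  let φ : MvPolynomial σ K →ₐ[K] MvPolynomial σ K := aeval fun i ↦ linearForm K σ (b i)
  let ψ : MvPolynomial σ K →ₐ[K] MvPolynomial σ K :=
    aeval fun i ↦ linearForm K σ (b.equivFun (Pi.single i 1))
  have hφ (a : σ → K) : φ (linearForm K σ a) = linearForm K σ (b.equivFun.symm a) := by
    simp [φ, linearForm_apply a, Module.Basis.equivFun_symm_apply]
  have hψ (a : σ → K) : ψ (linearForm K σ a) = linearForm K σ (b.equivFun a) := by
    rw [linearForm_apply, map_sum]
    simp only [map_smul, ψ, aeval_X]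
    simp only [← map_smul, ← map_sum]
    congr 2
    exact (pi_eq_sum_univ' a).symm
  have hX (i : σ) : linearForm K σ (Pi.single i 1) = X i := by
    rw [linearForm, Fintype.linearCombination_apply_single, one_smul]
  have hφψ (p : MvPolynomial σ K) : φ (ψ p) = p := by
    suffices φ.comp ψ = AlgHom.id K _ from DFunLike.congr_fun this p
    ext1 i
    rw [AlgHom.comp_apply, ← hX, hψ, hφ, LinearEquiv.symm_apply_apply, AlgHom.id_apply]
  have hψb (i : σ) : ψ (linearForm K σ (b i)) = X i := by
    rw [hψ, ← hX]; congr 1; ext; simp [Pi.single_apply, eq_comm]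
  have hφX (i : σ) : φ (X i) = linearForm K σ (b i) := aeval_X _ _
  rw [isSMulRegular_quotient_iff_mem_of_smul_mem]
  intro p hp
  have h1 := Ideal.mem_map_of_mem ψ hp
  rw [Ideal.map_span, Set.image_image, smul_eq_mul, map_mul, hψb] at h1
  simp only [hψb] at h1
  have h2 := (isSMulRegular_quotient_iff_mem_of_smul_mem _ _).mp
    (isSMulRegular_quotient_span_X_image hj) _ h1
  have h3 := Ideal.mem_map_of_mem φ h2
  rw [Ideal.map_span, Set.image_image, hφψ] at h3
  simpa only [hφX] using h3

theorem Submodule.exists_basis_fin_mem {K E : Type*} [Field K] [AddCommGroup E] [Module K E]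
    [FiniteDimensional K E] {n : ℕ} (hn : Module.finrank K E = n) (U : Submodule K E) :
    ∃ b : Module.Basis (Fin n) K E, ∀ i, i.val < Module.finrank K U → b i ∈ U := by
  obtain ⟨Q, hQ⟩ := U.exists_isCompl
  have hcard : Module.finrank K U + Module.finrank K Q = n := by
    rw [Submodule.finrank_add_eq_of_isCompl hQ, hn]
  let b := (((Module.finBasis K U).prod (Module.finBasis K Q)).map
    (Submodule.prodEquivOfIsCompl U Q hQ)).reindex (finSumFinEquiv.trans (finCongr hcard))
  refine ⟨b, fun i hi ↦ ?_⟩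
  have : i = (finSumFinEquiv.trans (finCongr hcard)) (Sum.inl ⟨i, hi⟩) := by ext; simp
  rw [this, Module.Basis.reindex_apply, Equiv.symm_apply_apply]
  simp

/-- **Proposition (kernel bound).** Let `S = K[x₀,…,x_n]` (char `K = 0`, algebraically
closed), `d ≥ 3`, and `I = (f₀,…,f_n)` with `f₀,…,f_n` a regular sequence of homogeneous
polynomials of degree `d - 1`; set `R = S/I` and `N = (d-2)(n+1)`.  Then for every
`1 ≤ h ≤ N - 1` and every nonzero `η ∈ R^h` one has
`h ≥ (d-2) · dim_K ker(·η : R¹ → R^(1+h))`. -/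
theorem kernel_dimension_bound
    {K : Type*} [Field K] [IsAlgClosed K] [CharZero K]
    {n d : ℕ} (hd : 3 ≤ d)
    (f : Fin (n + 1) → MvPolynomial (Fin (n + 1)) K)
    (hf : ∀ i, (f i).IsHomogeneous (d - 1))
    (hreg : RingTheory.Sequence.IsRegular (MvPolynomial (Fin (n + 1)) K) (List.ofFn f))
    (I : Ideal (MvPolynomial (Fin (n + 1)) K)) (hI : I = Ideal.span (Set.range f))
    (N : ℕ) (hN : N = (d - 2) * (n + 1))
    {h : ℕ} (hh1 : 1 ≤ h) (hh2 : h + 1 ≤ N)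
    {η : MvPolynomial (Fin (n + 1)) K ⧸ I} (hη : η ∈ gradedPiece I h) (hη0 : η ≠ 0) :
    (d - 2) *
      Module.finrank K
        ↥(gradedPiece I 1 ⊓ LinearMap.ker (LinearMap.mulLeft K η)) ≤ h := by
  obtain ⟨p, hp, rfl⟩ := hη
  let T := MvPolynomial.linearForm K (Fin (n + 1))
  have hT (a) : (T a).IsHomogeneous 1 := by
    rw [← MvPolynomial.mem_homogeneousSubmodule, ← MvPolynomial.range_linearForm]
    exact LinearMap.mem_range_self _ a
  set V := gradedPiece I 1 ⊓
    LinearMap.ker (LinearMap.mulLeft K ((Ideal.Quotient.mkₐ K I).toLinearMap p)) with hV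
  obtain ⟨U, hU⟩ : ∃ U : Submodule K (Fin (n + 1) → K),
      U = V.comap ((Ideal.Quotient.mkₐ K I).toLinearMap ∘ₗ T) := ⟨_, rfl⟩
  have hVU : Module.finrank K V ≤ Module.finrank K U := by
    have hmap : U.map ((Ideal.Quotient.mkₐ K I).toLinearMap ∘ₗ T) = V := by
      rw [hU, Submodule.map_comap_eq, LinearMap.range_comp, MvPolynomial.range_linearForm]
      exact inf_eq_right.mpr inf_le_left
    rw [← hmap]
    exact Submodule.finrank_map_le _ _
  obtain ⟨b, hb⟩ := U.exists_basis_fin_mem (n := n + 1) (by simp)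
  refine (Nat.mul_le_mul_left _ hVU).trans ?_
  have hofNat {j : ℕ} (hj : j ≤ n) : (Fin.ofNat (n + 1) j).val = j :=
    Nat.mod_eq_of_lt (by omega)
  have hkn : Module.finrank K U ≤ n + 1 := by simpa using U.finrank_le
  refine mul_pred_le_of_mul_mem_span (D := d - 1) (n := n) (by omega) f hf
    (fun j ↦ T (b (Fin.ofNat (n + 1) j))) (fun j ↦ hT _) (fun j hj ↦ ?_) (fun j hj ↦ ?_)
    hkn (η := p) hp ?_ fun j hj ↦ ?_
  · rw [MvPolynomial.linearForm_apply]
    exact sum_mem fun i _ ↦ Submodule.smul_of_tower_mem _ _ (X_mem_radical_of_isRegular f hf hreg i)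
  · have := MvPolynomial.isSMulRegular_quotient_span_linearForm_image b
      (s := Fin.ofNat (n + 1) '' Set.Iio j) (j := Fin.ofNat (n + 1) j) (by
        rintro ⟨i, hi, hij⟩
        have := congrArg Fin.val hij
        rw [Set.mem_Iio] at hi
        rw [hofNat hj, hofNat (by omega)] at this
        omega)
    rwa [Set.image_image] at this
  · rw [← hI, ← Ideal.Quotient.eq_zero_iff_mem]
    exact hη0
  · have hjU := hb (Fin.ofNat (n + 1) j) (by rwa [hofNat (by omega)])
    have hmem : T (b (Fin.ofNat (n + 1) j)) ∈ V.comap (Ideal.Quotient.mkₐ K I).toLinearMap :=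
      (hU ▸ hjU :)
    have : p * T (b (Fin.ofNat (n + 1) j)) ∈ I := by
      rw [← Ideal.Quotient.eq_zero_iff_mem, map_mul]
      exact hmem.2
    rwa [← hI, mul_comm]
end

section
/- Let K be an algebraically closed field of characteristic 0, S = K[x₀,…,x_n], d ≥ 3, and let I = (f₀,…,f_n) ⊆ S where f₀,…,f_n is a regular sequence of homogeneous polynomials of degree d−1. Set R = S/I and N = (d−2)(n+1). Let 1 ≤ h ≤ N−1 and let η, ζ ∈ R^h be nonzero elements with h = (d−2)·dim_K ker(·η : R¹ → R^{1+h}) = (d−2)·dim_K ker(·ζ : R¹ → R^{1+h}). Then ker(·η : R¹ → R^{1+h}) = ker(·ζ : R¹ → R^{1+h}) if and only if η and ζ are proportional, i.e., ζ = cη for some nonzero c ∈ K. -/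
section RegularChains

variable {K S : Type*} [Field K] [CommRing S] [Algebra K S]

/-- `u` is a nonzerodivisor modulo the ideal `J`. -/
def RegularModulo (J : Ideal S) (u : S) : Prop :=
  ∀ x, u * x ∈ J → x ∈ J

/-- `S / J` has no nonzero element annihilated by `W`. -/
def ColonTrivial (W J : Ideal S) : Prop :=
  ∀ z, (∀ x ∈ W, x * z ∈ J) → z ∈ J

/-- `T` arises from `J` by adjoining successively `r` homogeneous elements of `W`, each a
nonzerodivisor modulo the preceding ideal, whose degrees add up to `t - s`. -/
inductive RegularChain (𝒜 : ℕ → Submodule K S) (W : Ideal S) :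
    Ideal S → ℕ → ℕ → Ideal S → ℕ → Prop
  | refl (J : Ideal S) (s : ℕ) : RegularChain 𝒜 W J s 0 J s
  | cons {J T : Ideal S} {s t r a : ℕ} {u : S} (hW : u ∈ W) (ha : u ∈ 𝒜 a)
      (hu : RegularModulo J u) (h : RegularChain 𝒜 W (J ⊔ Ideal.span {u}) (s + a) r T t) :
      RegularChain 𝒜 W J s (r + 1) T t

/-- Any two elements of degree `a` whose classes in `S / J` are annihilated by `W` have
linearly dependent classes. -/
def ColonDependent (𝒜 : ℕ → Submodule K S) (W J : Ideal S) (a : ℕ) : Prop :=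
  ∀ η ∈ 𝒜 a, ∀ ζ ∈ 𝒜 a, (∀ x ∈ W, x * η ∈ J) → (∀ x ∈ W, x * ζ ∈ J) →
    ∃ c c' : K, (c ≠ 0 ∨ c' ≠ 0) ∧ c • η + c' • ζ ∈ J

theorem Ideal.mem_sup_span_singleton_iff {J : Ideal S} {u x : S} :
    x ∈ J ⊔ Ideal.span {u} ↔ ∃ t, x - u * t ∈ J := by
  rw [Submodule.mem_sup]
  constructor
  · rintro ⟨j, hj, y, hy, rfl⟩
    obtain ⟨t, rfl⟩ := Ideal.mem_span_singleton.1 hy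
    exact ⟨t, by simpa using hj⟩
  · rintro ⟨t, ht⟩
    exact ⟨_, ht, u * t, Ideal.mem_span_singleton.2 ⟨t, rfl⟩, by ring⟩

theorem RegularModulo.sup_span_singleton {J : Ideal S} {u w : S} (hu : RegularModulo J u)
    (hw : RegularModulo (J ⊔ Ideal.span {u}) w) :
    RegularModulo (J ⊔ Ideal.span {w}) u := by
  intro x hx
  obtain ⟨y, hy⟩ := Ideal.mem_sup_span_singleton_iff.1 hx
  obtain ⟨t, ht⟩ := Ideal.mem_sup_span_singleton_iff.1 (hw y
    (Ideal.mem_sup_span_singleton_iff.2 ⟨x, by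
      have := J.neg_mem hy
      rwa [neg_sub] at this⟩))
  refine Ideal.mem_sup_span_singleton_iff.2 ⟨t, hu _ ?_⟩
  have := J.add_mem hy (J.mul_mem_left w ht)
  ring_nf at this ⊢
  exact this

/-- If `v * z = u * z'` modulo `J` and `z` is annihilated by `W` modulo `J + (u)`, then `z'` is
annihilated by `W` modulo `J + (v)`. -/
theorem RegularModulo.colon_transfer {W J : Ideal S} {u v z z' : S} (hu : RegularModulo J u)
    (hz : ∀ x ∈ W, x * z ∈ J ⊔ Ideal.span {u}) (h : v * z - u * z' ∈ J) :
    ∀ x ∈ W, x * z' ∈ J ⊔ Ideal.span {v} := by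
  intro x hx
  obtain ⟨t, ht⟩ := Ideal.mem_sup_span_singleton_iff.1 (hz x hx)
  refine Ideal.mem_sup_span_singleton_iff.2 ⟨t, hu _ ?_⟩
  have := J.sub_mem (J.mul_mem_left v ht) (J.mul_mem_left x h)
  ring_nf at this ⊢
  exact this

/-- If `v * z = u * z'` modulo `J` and `z' ∈ J + (v)`, then `z ∈ J + (u)`. -/
theorem RegularModulo.mem_transfer {J : Ideal S} {u v z z' : S} (hv : RegularModulo J v)
    (h : v * z - u * z' ∈ J) (hz' : z' ∈ J ⊔ Ideal.span {v}) : z ∈ J ⊔ Ideal.span {u} := by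
  obtain ⟨t, ht⟩ := Ideal.mem_sup_span_singleton_iff.1 hz'
  refine Ideal.mem_sup_span_singleton_iff.2 ⟨t, hv _ ?_⟩
  have := J.add_mem h (J.mul_mem_left u ht)
  ring_nf at this ⊢
  exact this

theorem ColonTrivial.exchange {W J : Ideal S} {u v : S} (hvW : v ∈ W)
    (hu : RegularModulo J u) (hv : RegularModulo J v)
    (h : ColonTrivial W (J ⊔ Ideal.span {v})) : ColonTrivial W (J ⊔ Ideal.span {u}) := by
  intro z hz
  obtain ⟨z', hz'⟩ := Ideal.mem_sup_span_singleton_iff.1 (hz v hvW)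
  exact hv.mem_transfer hz' (h z' (hu.colon_transfer hz hz'))

theorem RegularChain.colonTrivial {𝒜 : ℕ → Submodule K S} {W J J' : Ideal S} {s s' r : ℕ}
    (h : RegularChain 𝒜 W J s (r + 1) J' s') : ColonTrivial W J := by
  cases h with
  | cons hW ha hu h => exact fun z hz => hu z (hz _ hW)

theorem RegularChain.trans {𝒜 : ℕ → Submodule K S} {W J J' J'' : Ideal S} {s s' s'' r r' : ℕ}
    (h : RegularChain 𝒜 W J s r J' s') (h' : RegularChain 𝒜 W J' s' r' J'' s'') :
    RegularChain 𝒜 W J s (r' + r) J'' s'' := by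
  induction h with
  | refl J s => exact h'
  | cons hW ha hu h ih => exact .cons hW ha hu (ih h')

theorem ColonDependent.exchange {𝒜 : ℕ → Submodule K S} [GradedAlgebra 𝒜] {W J : Ideal S}
    {u v : S} {a b d : ℕ} (hJ : J.IsHomogeneous 𝒜) (hvW : v ∈ W)
    (hua : u ∈ 𝒜 a) (hvb : v ∈ 𝒜 b) (hu : RegularModulo J u) (hv : RegularModulo J v)
    (h : ∀ d', d' + a = d + b → ColonDependent 𝒜 W (J ⊔ Ideal.span {v}) d') :
    ColonDependent 𝒜 W (J ⊔ Ideal.span {u}) d := by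
  have key : ∀ z ∈ 𝒜 d, (∀ x ∈ W, x * z ∈ J ⊔ Ideal.span {u}) →
      if a ≤ d + b then ∃ z' ∈ 𝒜 (d + b - a), v * z - u * z' ∈ J else z ∈ J := by
    intro z hzd hz
    obtain ⟨z', hz'⟩ := Ideal.mem_sup_span_singleton_iff.1 (hz v hvW)
    have hd : v * z ∈ 𝒜 (d + b) := by
      rw [add_comm]
      exact SetLike.mul_mem_graded hvb hzd
    have hc := hJ (d + b) hz'
    rw [DirectSum.decompose_sub, DirectSum.sub_apply, Submodule.coe_sub,
      DirectSum.decompose_of_mem_same 𝒜 hd,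
      DirectSum.coe_decompose_mul_of_left_mem 𝒜 (d + b) hua] at hc
    split_ifs at hc ⊢ with hab
    · exact ⟨_, SetLike.coe_mem _, hc⟩
    · exact hv z (by simpa using hc)
  intro η hη ζ hζ hWη hWζ
  have h1 := key η hη hWη
  have h2 := key ζ hζ hWζ
  split_ifs at h1 h2 with hab
  · obtain ⟨η', hη', h1⟩ := h1
    obtain ⟨ζ', hζ', h2⟩ := h2
    obtain ⟨c, c', hcc, hmem⟩ := h (d + b - a) (by omega) η' hη' ζ' hζ'
      (hu.colon_transfer hWη h1) (hu.colon_transfer hWζ h2)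
    refine ⟨c, c', hcc, hv.mem_transfer ?_ hmem⟩
    have := J.add_mem (Submodule.smul_of_tower_mem J c h1) (Submodule.smul_of_tower_mem J c' h2)
    convert this using 1
    simp only [Algebra.smul_def]
    ring
  · exact ⟨1, 0, by simp, by simpa using Ideal.mem_sup_left h1⟩

theorem RegularChain.of_isWeaklyRegular {𝒜 : ℕ → Submodule K S} {W : Ideal S} {e : ℕ}
    (rs : List S) (h : RingTheory.Sequence.IsWeaklyRegular S rs) (hW : ∀ x ∈ rs, x ∈ W)
    (he : ∀ x ∈ rs, x ∈ 𝒜 e) :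
    RegularChain 𝒜 W ⊥ 0 rs.length (Ideal.ofList rs) (rs.length * e) := by
  induction rs using List.reverseRecOn with
  | nil => simpa using RegularChain.refl _ _
  | append_singleton rs x ih =>
    rw [RingTheory.Sequence.isWeaklyRegular_append_iff,
      RingTheory.Sequence.isWeaklyRegular_singleton_iff] at h
    have hx : RegularModulo (Ideal.ofList rs) x := by
      intro y hy
      have := h.2.right_eq_zero_of_smul (x := Submodule.Quotient.mk y) (by
        rw [← Submodule.Quotient.mk_smul, Submodule.Quotient.mk_eq_zero]
        simpa using hy)
      rw [Submodule.Quotient.mk_eq_zero] at this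
      simpa using this
    have step : RegularChain 𝒜 W (Ideal.ofList rs) (rs.length * e) 1
        (Ideal.ofList rs ⊔ Ideal.span {x}) (rs.length * e + e) :=
      .cons (hW x (by simp)) (he x (by simp)) hx (.refl _ _)
    have := (ih h.1 (fun y hy => hW y (by simp [hy])) fun y hy => he y (by simp [hy])).trans step
    simpa [add_comm, add_mul, Ideal.ofList_append, Ideal.ofList_singleton] using this

variable [IsNoetherianRing S]

/-- Homogeneous prime avoidance in a fixed degree `e`. -/
theorem exists_regularModulo_pair [Infinite K] (𝒜 : ℕ → Submodule K S) {W J₁ J₂ : Ideal S} {e : ℕ}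
    (hE : ∀ P : Ideal S, P.IsPrime → (∀ x ∈ W, x ∈ 𝒜 e → x ∈ P) → W ≤ P)
    (h₁ : ColonTrivial W J₁) (h₂ : ColonTrivial W J₂) :
    ∃ w ∈ W, w ∈ 𝒜 e ∧ RegularModulo J₁ w ∧ RegularModulo J₂ w := by
  classical
  have fin (J : Ideal S) : (associatedPrimes S (S ⧸ J)).Finite := associatedPrimes.finite S _
  let E : Submodule K S := W.restrictScalars K ⊓ 𝒜 e
  let T : Finset (Ideal S) := (fin J₁).toFinset ∪ (fin J₂).toFinset
  have not_le (J : Ideal S) (hJ : ColonTrivial W J) (P : Ideal S)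
      (hP : P ∈ associatedPrimes S (S ⧸ J)) : ¬ W ≤ P := by
    intro hWP
    obtain ⟨hprime, x, rfl⟩ := Submodule.isAssociatedPrime_iff.1 hP
    obtain ⟨z, rfl⟩ := Ideal.Quotient.mk_surjective x
    have hz : z ∈ J := hJ z fun y hy => by
      have := Submodule.mem_colon_singleton.1 (hWP hy)
      rwa [Submodule.mem_bot, Algebra.smul_def, Ideal.Quotient.algebraMap_eq, ← map_mul,
        Ideal.Quotient.eq_zero_iff_mem] at this
    apply hprime.ne_top
    rw [Ideal.Quotient.eq_zero_iff_mem.2 hz]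
    simp
  have hT : ∀ P ∈ T, P.IsPrime ∧ ¬ W ≤ P := by
    intro P hP
    simp only [T, Finset.mem_union, Set.Finite.mem_toFinset] at hP
    rcases hP with hP | hP
    · exact ⟨hP.1, not_le _ h₁ P hP⟩
    · exact ⟨hP.1, not_le _ h₂ P hP⟩
  have hcover := Subspace.biUnion_ne_univ_of_top_notMem (k := K) (E := E)
    (s := T.image fun P => (P.restrictScalars K).comap E.subtype) (by
      intro htop
      obtain ⟨P, hP, hPtop⟩ := Finset.mem_image.1 htop
      refine (hT P hP).2 (hE P (hT P hP).1 fun x hxW hxe => ?_)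
      have : (⟨x, hxW, hxe⟩ : E) ∈ (P.restrictScalars K).comap E.subtype := by
        rw [hPtop]
        trivial
      exact this)
  obtain ⟨w, hw⟩ := (Set.ne_univ_iff_exists_notMem _).1 hcover
  simp only [Finset.mem_image, Set.iUnion_exists, Set.biUnion_and', Set.iUnion_iUnion_eq_right,
    Set.mem_iUnion, not_exists] at hw
  have reg (J : Ideal S) (hJ : ∀ P ∈ associatedPrimes S (S ⧸ J), P ∈ T) :
      RegularModulo J (w : S) := by
    have hw' : (w : S) ∈ { r : S | IsSMulRegular (S ⧸ J) r } := by
      rw [← compl_compl { r : S | IsSMulRegular (S ⧸ J) r },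
        ← biUnion_associatedPrimes_eq_compl_regular S (S ⧸ J)]
      simp only [Set.mem_compl_iff, Set.mem_iUnion, not_exists]
      exact fun P hP hPw => hw P (hJ P hP) hPw
    intro x hx
    rw [← Ideal.Quotient.eq_zero_iff_mem]
    refine hw'.right_eq_zero_of_smul ?_
    rwa [Algebra.smul_def, Ideal.Quotient.algebraMap_eq, ← map_mul,
      Ideal.Quotient.eq_zero_iff_mem]
  exact ⟨w, w.2.1, w.2.2, reg J₁ fun P hP => by simp [T, hP], reg J₂ fun P hP => by simp [T, hP]⟩

/-- A nonzerodivisor can replace the first element of a chain, the others being chosen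
in degree `e`. -/
theorem RegularChain.exists_exchange [Infinite K] {𝒜 : ℕ → Submodule K S} {W : Ideal S} {e : ℕ}
    (hE : ∀ P : Ideal S, P.IsPrime → (∀ x ∈ W, x ∈ 𝒜 e → x ∈ P) → W ≤ P) (r : ℕ) :
    ∀ {J J' : Ideal S} {s s' t : ℕ} {w : S}, RegularChain 𝒜 W J s (r + 1) J' s' →
      w ∈ W → RegularModulo J w →
      ∃ X, RegularChain 𝒜 W (J ⊔ Ideal.span {w}) t r X (t + r * e) := by
  induction r with
  | zero => exact fun _ _ _ => ⟨_, by simpa using .refl _ _⟩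
  | succ r ih =>
    intro J J' s s' t w h hwW hw
    cases h with
    | @cons _ _ _ _ _ a u hW ha hu h =>
    obtain ⟨w', hw'W, hw'e, h1, h2⟩ := exists_regularModulo_pair 𝒜 hE h.colonTrivial
      (h.colonTrivial.exchange hW hw hu)
    obtain ⟨X, hX⟩ := ih (t := 0 + a) h hw'W h1
    rw [sup_right_comm] at hX
    obtain ⟨X', hX'⟩ := ih (t := t + e) (RegularChain.cons hW ha (hu.sup_span_singleton h1) hX) hwW
      (hw.sup_span_singleton h2)
    rw [sup_right_comm] at hX'
    exact ⟨X', .cons hw'W hw'e h2 (by convert hX' using 1; ring)⟩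

/-- The graded invariance of `(J' : W) / J'` under change of the chain from `J` to `J'`. -/
theorem RegularChain.colonDependent [Infinite K] {𝒜 : ℕ → Submodule K S} [GradedAlgebra 𝒜]
    {W : Ideal S} {e : ℕ}
    (hE : ∀ P : Ideal S, P.IsPrime → (∀ x ∈ W, x ∈ 𝒜 e → x ∈ P) → W ≤ P) (r : ℕ) :
    ∀ {J J₁ J₂ : Ideal S} {s s₁ s₂ d : ℕ}, J.IsHomogeneous 𝒜 →
      RegularChain 𝒜 W J s r J₁ s₁ → RegularChain 𝒜 W J s r J₂ s₂ →
      (∀ d', d' + s₁ = d + s₂ → ColonDependent 𝒜 W J₂ d') → ColonDependent 𝒜 W J₁ d := by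
  have hom {J : Ideal S} {u : S} {a : ℕ} (hJ : J.IsHomogeneous 𝒜) (hu : u ∈ 𝒜 a) :
      (J ⊔ Ideal.span {u}).IsHomogeneous 𝒜 :=
    hJ.sup (Ideal.homogeneous_span 𝒜 _ (by rintro x rfl; exact ⟨a, hu⟩))
  induction r with
  | zero =>
    intro J J₁ J₂ s s₁ s₂ d hJ h₁ h₂ h
    cases h₁
    cases h₂
    exact h d rfl
  | succ r ih =>
    intro J J₁ J₂ s s₁ s₂ d hJ h₁ h₂ h
    cases h₁ with
    | @cons _ _ _ _ _ a u huW hua hu h₁ =>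
    cases h₂ with
    | @cons _ _ _ _ _ b v hvW hvb hv h₂ =>
    rcases r with _ | r
    · cases h₁
      cases h₂
      exact ColonDependent.exchange hJ hvW hua hvb hu hv fun d' hd' => h d' (by omega)
    · obtain ⟨w, hwW, hwe, h1, h2⟩ :=
        exists_regularModulo_pair 𝒜 hE h₁.colonTrivial h₂.colonTrivial
      obtain ⟨X₁, hX₁⟩ := RegularChain.exists_exchange hE _ (t := s + a + e) h₁ hwW h1
      obtain ⟨X₂, hX₂⟩ := RegularChain.exists_exchange hE _ (t := s + b + e) h₂ hwW h2
      have through {J : Ideal S} {a : ℕ} {u : S} {X : Ideal S} {t : ℕ} (huW : u ∈ W)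
          (hua : u ∈ 𝒜 a) (hu : RegularModulo J u) (hw : RegularModulo (J ⊔ Ideal.span {u}) w)
          (hX : RegularChain 𝒜 W (J ⊔ Ideal.span {u} ⊔ Ideal.span {w}) (s + a + e) r X t) :
          RegularChain 𝒜 W (J ⊔ Ideal.span {w}) (s + e) (r + 1) X t := by
        rw [sup_right_comm, add_right_comm] at hX
        exact .cons huW hua (hu.sup_span_singleton hw) hX
      refine ih (hom hJ hua) h₁ (.cons hwW hwe h1 hX₁) fun d₁ hd₁ => ?_
      refine ih (hom hJ hwe) (through huW hua hu h1 hX₁) (through hvW hvb hv h2 hX₂)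
        fun d₂ hd₂ => ?_
      exact ih (hom hJ hvb) (.cons hwW hwe h2 hX₂) h₂ fun d₃ hd₃ => h d₃ (by omega)

/-- A chain extends, by elements of degree `e`, to the length of any other chain. -/
theorem RegularChain.exists_extension [Infinite K] {𝒜 : ℕ → Submodule K S}
    {W : Ideal S} {e : ℕ}
    (hE : ∀ P : Ideal S, P.IsPrime → (∀ x ∈ W, x ∈ 𝒜 e → x ∈ P) → W ≤ P) {m : ℕ}
    {J J' : Ideal S} {s s' r : ℕ} (h : RegularChain 𝒜 W J s r J' s') :
    (∃ X, RegularChain 𝒜 W J s (m + r) X (s + (m + r) * e)) →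
      ∃ X, RegularChain 𝒜 W J' s' m X (s' + m * e) := by
  induction h with
  | refl J s => simp
  | cons hW ha hu h ih =>
    rintro ⟨X, hX⟩
    exact ih (RegularChain.exists_exchange hE _ hX hW hu)

end RegularChains

section LinearForms

open MvPolynomial

variable {K σ ι : Type*} [Field K]

theorem MvPolynomial.regularModulo_span_X {s : Set ι} {j : ι} (hj : j ∉ s) :
    RegularModulo (Ideal.span (X '' s : Set (MvPolynomial ι K))) (X j) := by
  intro x hx
  rw [mem_ideal_span_X_image] at hx ⊢
  intro m hm
  obtain ⟨i, hi, hmi⟩ := hx (Finsupp.single j 1 + m) (by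
    rw [support_X_mul]
    simpa using hm)
  refine ⟨i, hi, ?_⟩
  have : j ≠ i := fun h => hj (h ▸ hi)
  simpa [Finsupp.single_apply, this] using hmi

/-- A linear form is a nonzerodivisor modulo linear forms which together with it are linearly
independent. -/
theorem MvPolynomial.regularModulo_span_linearForms {l : ι → MvPolynomial σ K}
    (hl : ∀ i, (l i).IsHomogeneous 1) (hli : LinearIndependent K l) {s : Set ι} {j : ι}
    (hj : j ∉ s) : RegularModulo (Ideal.span (l '' s)) (l j) := by
  let E := homogeneousSubmodule σ K 1
  let v : ι → E := fun i => ⟨l i, hl i⟩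
  have hv : LinearIndependent K v := LinearIndependent.of_comp E.subtype hli
  let b := Module.Basis.sumExtend hv
  have hb (i : ι) : b (Sum.inl i) = v i := by
    simp only [b, Module.Basis.sumExtend, Module.Basis.reindex_apply, Module.Basis.extend_apply_self]
    rfl
  let g := b.constr K (X : _ → MvPolynomial _ K)
  let φ := aeval (R := K) fun i => (b i : MvPolynomial σ K)
  let x : σ → E := fun i => ⟨X i, isHomogeneous_X _ _⟩
  let ψ := aeval (R := K) fun i => g (x i)
  have hφg (y : E) : φ (g y) = y := by
    have : φ.toLinearMap ∘ₗ g = E.subtype := b.ext fun i => by simp [g, φ]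
    exact LinearMap.congr_fun this y
  have hψ (y : E) : ψ y = g y := by
    obtain ⟨y, hy⟩ := y
    have hy' : y ∈ Submodule.span K (Set.range (X : σ → MvPolynomial σ K)) := by
      rwa [← homogeneousSubmodule_one_eq_span_X]
    induction hy' using Submodule.span_induction with
    | mem y h =>
      obtain ⟨i, rfl⟩ := h
      simp [ψ, x]
    | zero => rw [map_zero]; exact (map_zero g).symm
    | add y z hy' hz' ihy ihz =>
      rw [← homogeneousSubmodule_one_eq_span_X] at hy' hz'
      rw [map_add, ihy hy', ihz hz', ← map_add]
      rfl
    | smul c y hy' ih =>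
      rw [← homogeneousSubmodule_one_eq_span_X] at hy'
      rw [map_smul, ih hy', ← map_smul]
      rfl
  have hψl (i : ι) : ψ (l i) = X (Sum.inl i) := by
    rw [show l i = (v i : MvPolynomial σ K) from rfl, hψ, ← hb]
    simp [g]
  have hφX (i : ι) : φ (X (Sum.inl i)) = l i := by simp [φ, hb, v]
  have hφψ (p : MvPolynomial σ K) : φ (ψ p) = p := by
    have : φ.comp ψ = AlgHom.id K _ := algHom_ext fun i => by simp [ψ, hφg, x]
    exact AlgHom.congr_fun this p
  intro p hp
  have hψp := Ideal.mem_map_of_mem ψ hp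
  rw [Ideal.map_span, map_mul, hψl, ← Set.image_comp,
    show (ψ : _ → _) ∘ l = X ∘ Sum.inl from _root_.funext hψl, Set.image_comp] at hψp
  have hmem := Ideal.mem_map_of_mem φ (regularModulo_span_X (by simpa using hj) _ hψp)
  rwa [Ideal.map_span, hφψ, ← Set.image_comp, ← Set.image_comp,
    show ((φ : _ → _) ∘ X) ∘ Sum.inl = l from _root_.funext hφX] at hmem

theorem RegularChain.of_linearForms {W : Ideal (MvPolynomial σ K)} {k : ℕ}
    {l : Fin k → MvPolynomial σ K} (hl : ∀ i, (l i).IsHomogeneous 1)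
    (hli : LinearIndependent K l) (hW : ∀ i, l i ∈ W) :
    ∃ J, RegularChain (homogeneousSubmodule σ K) W ⊥ 0 k J k := by
  suffices h : ∀ j ≤ k, RegularChain (homogeneousSubmodule σ K) W ⊥ 0 j
      (Ideal.span (l '' {i | i.val < j})) j from ⟨_, h k le_rfl⟩
  intro j
  induction j with
  | zero => simpa using RegularChain.refl _ _
  | succ j ih =>
    intro hj
    have step : RegularChain (homogeneousSubmodule σ K) W (Ideal.span (l '' {i | i.val < j})) j 1
        (Ideal.span (l '' {i | i.val < j}) ⊔ Ideal.span {l ⟨j, hj⟩}) (j + 1) :=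
      .cons (hW _) (hl _) (regularModulo_span_linearForms hl hli (by simp)) (.refl _ _)
    convert (ih (by omega)).trans step using 1
    · omega
    · rw [← Ideal.span_union, ← Set.image_singleton, ← Set.image_union]
      congr 2
      ext i
      simp only [Set.mem_union, Set.mem_ofPred_eq, Set.mem_singleton_iff, Fin.ext_iff]
      omega

theorem MvPolynomial.colonDependent_zero (W J : Ideal (MvPolynomial σ K)) :
    ColonDependent (homogeneousSubmodule σ K) W J 0 := by
  intro η hη ζ hζ _ _
  rw [homogeneousSubmodule_zero, Submodule.mem_one] at hη hζ
  obtain ⟨a, rfl⟩ := hη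
  obtain ⟨b, rfl⟩ := hζ
  by_cases ha : a = 0
  · exact ⟨1, 0, by simp, by simp [ha]⟩
  · refine ⟨-b, a, Or.inr ha, ?_⟩
    rw [Algebra.smul_def, Algebra.smul_def, ← map_mul, ← map_mul, ← map_add]
    simp [mul_comm]

/-- For a complete intersection `I` of `k + m` forms of degree `δ + 1`, the elements of degree
`δ * k` of the quotient by `I` annihilated by `k` given independent linear forms make up a space
of dimension at most one. -/
theorem MvPolynomial.colonDependent_of_isWeaklyRegular [Infinite K] [Finite σ]
    {k m δ : ℕ} {rs : List (MvPolynomial σ K)} {l : Fin k → MvPolynomial σ K}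
    (hlen : rs.length = k + m) (hrs : ∀ x ∈ rs, x.IsHomogeneous (δ + 1))
    (hreg : RingTheory.Sequence.IsWeaklyRegular (MvPolynomial σ K) rs)
    (hl : ∀ i, (l i).IsHomogeneous 1) (hli : LinearIndependent K l) :
    ColonDependent (homogeneousSubmodule σ K) (Ideal.ofList rs ⊔ Ideal.span (Set.range l))
      (Ideal.ofList rs) (δ * k) := by
  let := MvPolynomial.gradedAlgebra (σ := σ) (R := K)
  set W := Ideal.ofList rs ⊔ Ideal.span (Set.range l) with hW
  have hrsW : ∀ x ∈ rs, x ∈ W := fun x hx => Ideal.mem_sup_left (Ideal.subset_span hx)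
  have hlW : ∀ i, l i ∈ W := fun i => Ideal.mem_sup_right (Ideal.subset_span ⟨i, rfl⟩)
  have hE : ∀ P : Ideal (MvPolynomial σ K), P.IsPrime →
      (∀ x ∈ W, x ∈ homogeneousSubmodule σ K (δ + 1) → x ∈ P) → W ≤ P := by
    intro P hP h
    refine sup_le (Ideal.span_le.2 fun x hx => h x (hrsW x hx) (hrs x hx)) (Ideal.span_le.2 ?_)
    rintro _ ⟨i, rfl⟩
    refine hP.mem_of_pow_mem (δ + 1) (h _ (W.pow_mem_of_mem (hlW i) _ δ.succ_pos) ?_)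
    simpa using (hl i).pow (δ + 1)
  have h₁ := RegularChain.of_isWeaklyRegular (𝒜 := homogeneousSubmodule σ K) rs hreg hrsW hrs
  rw [hlen] at h₁
  obtain ⟨J, hJ⟩ := RegularChain.of_linearForms hl hli hlW
  obtain ⟨X, hX⟩ := RegularChain.exists_extension hE (m := m) hJ
    ⟨_, by rw [zero_add, add_comm m]; exact h₁⟩
  have h₂ := hJ.trans hX
  rw [add_comm m] at h₂
  refine RegularChain.colonDependent hE _ (Ideal.IsHomogeneous.bot _) h₁ h₂ fun d' hd' => ?_
  obtain rfl : d' = 0 := by linarith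
  exact colonDependent_zero W X

end LinearForms


/-- **Proposition (equal kernels).** Let `S = K[x₀,…,x_n]` (char `K = 0`, algebraically
closed), `d ≥ 3`, and `I = (f₀,…,f_n)` with `f₀,…,f_n` a regular sequence of homogeneous
polynomials of degree `d - 1`; set `R = S/I` and `N = (d-2)(n+1)`.  Let `1 ≤ h ≤ N - 1`
and let `η, ζ ∈ R^h` be nonzero with
`h = (d-2)·dim ker(·η : R¹ → R^(1+h)) = (d-2)·dim ker(·ζ : R¹ → R^(1+h))`.  Then the two
kernels coincide if and only if `ζ = c·η` for some nonzero `c ∈ K`. -/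
theorem equal_kernels_iff_proportional
    {K : Type*} [Field K] [IsAlgClosed K] [CharZero K]
    {n d : ℕ} (hd : 3 ≤ d)
    (f : Fin (n + 1) → MvPolynomial (Fin (n + 1)) K)
    (hf : ∀ i, (f i).IsHomogeneous (d - 1))
    (hreg : RingTheory.Sequence.IsRegular (MvPolynomial (Fin (n + 1)) K) (List.ofFn f))
    (I : Ideal (MvPolynomial (Fin (n + 1)) K)) (hI : I = Ideal.span (Set.range f))
    (N : ℕ) (hN : N = (d - 2) * (n + 1))
    {h : ℕ} (hh1 : 1 ≤ h) (hh2 : h + 1 ≤ N)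
    {η ζ : MvPolynomial (Fin (n + 1)) K ⧸ I}
    (hη : η ∈ gradedPiece I h) (hη0 : η ≠ 0)
    (hζ : ζ ∈ gradedPiece I h) (hζ0 : ζ ≠ 0)
    (hηdim : h = (d - 2) *
      Module.finrank K ↥(gradedPiece I 1 ⊓ LinearMap.ker (LinearMap.mulLeft K η)))
    (hζdim : h = (d - 2) *
      Module.finrank K ↥(gradedPiece I 1 ⊓ LinearMap.ker (LinearMap.mulLeft K ζ))) :
    (gradedPiece I 1 ⊓ LinearMap.ker (LinearMap.mulLeft K η) =
        gradedPiece I 1 ⊓ LinearMap.ker (LinearMap.mulLeft K ζ)) ↔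
      ∃ c : K, c ≠ 0 ∧ ζ = c • η := by
  subst hI
  subst hN
  constructor
  · intro hker
    set V := gradedPiece (Ideal.span (Set.range f)) 1 ⊓ LinearMap.ker (LinearMap.mulLeft K η)
    set k := Module.finrank K V with hk
    have : Module.Free K V := Module.Free.of_divisionRing K V
    have : FiniteDimensional K V := Module.finite_of_finrank_pos (by
      rw [← hk, Nat.pos_iff_ne_zero]
      rintro h0
      rw [h0] at hηdim
      omega)
    obtain ⟨δ, rfl⟩ : ∃ δ, d = δ + 2 := ⟨d - 2, by omega⟩
    simp only [Nat.add_sub_cancel] at hηdim hh2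
    have hkn : k ≤ n + 1 := by
      refine Nat.le_of_mul_le_mul_left ?_ (show 0 < δ by omega)
      omega
    let b := Module.finBasis K V
    choose l hl hlb using fun i => (b i).2.1
    have hlb' (i) : Ideal.Quotient.mk (Ideal.span (Set.range f)) (l i) = b i := hlb i
    have hli : LinearIndependent K l := by
      refine LinearIndependent.of_comp
        (Ideal.Quotient.mkₐ K (Ideal.span (Set.range f))).toLinearMap ?_
      rw [show (Ideal.Quotient.mkₐ K (Ideal.span (Set.range f))).toLinearMap ∘ l =
        V.subtype ∘ b from funext hlb]
      exact b.linearIndependent.map' _ V.ker_subtype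
    have hfI : Ideal.ofList (List.ofFn f) = Ideal.span (Set.range f) := by
      simp only [Ideal.ofList, List.mem_ofFn', Set.ofPred_mem_eq]
    have hdep := MvPolynomial.colonDependent_of_isWeaklyRegular (m := n + 1 - k) (δ := δ)
      (by simp; omega) (List.forall_mem_ofFn_iff.2 hf) hreg.toIsWeaklyRegular hl hli
    rw [hfI, ← hηdim] at hdep
    have hann (θ : MvPolynomial (Fin (n + 1)) K)
        (hθ : ∀ i, (b i : MvPolynomial (Fin (n + 1)) K ⧸ Ideal.span (Set.range f)) ∈
          LinearMap.ker (LinearMap.mulLeft K (Ideal.Quotient.mk _ θ))) :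
        ∀ x ∈ Ideal.span (Set.range f) ⊔ Ideal.span (Set.range l),
          x * θ ∈ Ideal.span (Set.range f) := by
      suffices h : Ideal.span (Set.range f) ⊔ Ideal.span (Set.range l) ≤
          (Ideal.span (Set.range f)).colon {θ} from
        fun x hx => Submodule.mem_colon_singleton.1 (h hx)
      refine sup_le (fun x hx => Submodule.mem_colon_singleton.2 (Ideal.mul_mem_right _ _ hx))
        (Ideal.span_le.2 ?_)
      rintro _ ⟨i, rfl⟩
      refine Submodule.mem_colon_singleton.2 ?_
      rw [smul_eq_mul, ← Ideal.Quotient.eq_zero_iff_mem, map_mul, hlb', mul_comm]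
      exact hθ i
    obtain ⟨η', hη', rfl⟩ := hη
    obtain ⟨ζ', hζ', rfl⟩ := hζ
    obtain ⟨c, c', hcc, hmem⟩ := hdep η' hη' ζ' hζ' (hann η' fun i => (b i).2.2)
      (hann ζ' fun i => (hker.le (b i).2).2)
    replace hmem : c • (Ideal.Quotient.mkₐ K (Ideal.span (Set.range f))).toLinearMap η' +
        c' • (Ideal.Quotient.mkₐ K (Ideal.span (Set.range f))).toLinearMap ζ' = 0 := by
      rw [← map_smul, ← map_smul, ← map_add]
      exact Ideal.Quotient.eq_zero_iff_mem.2 hmem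
    have hc' : c' ≠ 0 := by
      rintro rfl
      simp_all
    have hc : c ≠ 0 := by
      rintro rfl
      simp_all
    refine ⟨-(c'⁻¹ * c), by simp [hc, hc'], ?_⟩
    rw [neg_smul, mul_smul, eq_neg_of_add_eq_zero_left hmem, smul_neg, neg_neg,
      inv_smul_smul₀ hc']
  · rintro ⟨c, hc, rfl⟩
    congr 1
    ext x
    simp [smul_mul_assoc, hc]
end

section
/- Let K be an algebraically closed field of characteristic 0, S = K[x₀,…,x_n], and let I ⊆ S be an ideal generated by a regular sequence of n+1 homogeneous polynomials, all of the same degree e ≥ 2. Then R = S/I has the weak Lefschetz property in degree 1: there exists x ∈ R¹ such that the multiplication map x· : R¹ → R² has maximal rank (i.e., it is injective or surjective). -/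
section LinearPencil

variable {K U V W : Type*} [Field K] [AddCommGroup U] [Module K U] [FiniteDimensional K U]
  [AddCommGroup V] [Module K V] [FiniteDimensional K V] [AddCommGroup W] [Module K W]

/-- An injective linear map stays injective along all but finitely many members of a pencil. -/
lemma LinearMap.finite_not_injective_add_smul (P Q : U →ₗ[K] W) (hP : Function.Injective P) :
    {ε : K | ¬ Function.Injective (P + ε • Q)}.Finite := by
  obtain ⟨N, hN⟩ := P.exists_leftInverse_of_injective (LinearMap.ker_eq_bot.2 hP)
  refine ((Module.End.finite_hasEigenvalue (N ∘ₗ Q)).image fun μ => -μ⁻¹).subset fun ε hε => ?_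
  have hε' : ¬ LinearMap.ker (P + ε • Q) = ⊥ := fun h => hε (LinearMap.ker_eq_bot.1 h)
  obtain ⟨u, hu, hu0⟩ := (Submodule.ne_bot_iff _).1 hε'
  have hu' : u + ε • N (Q u) = 0 := by
    have h := congrArg N (LinearMap.mem_ker.1 hu)
    have hPu : N (P u) = u := LinearMap.congr_fun hN u
    simpa [hPu] using h
  have hε0 : ε ≠ 0 := by
    rintro rfl
    exact hu0 (by simpa using hu')
  refine ⟨-ε⁻¹, Module.End.hasEigenvalue_of_hasEigenvector (x := u)
    ⟨Module.End.mem_eigenspace_iff.2 ?_, hu0⟩, by simp⟩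
  have : N (Q u) = ε⁻¹ • (ε • N (Q u)) := by rw [inv_smul_smul₀ hε0]
  rw [LinearMap.comp_apply, this, eq_neg_of_add_eq_zero_right hu', smul_neg, neg_smul]

omit [FiniteDimensional K V] in
lemma LinearMap.injective_comp_subtype_of_isCompl_ker (A : V →ₗ[K] W) {C : Submodule K V}
    (hC : IsCompl (LinearMap.ker A) C) : Function.Injective (A ∘ₗ C.subtype) := by
  rw [← LinearMap.ker_eq_bot, LinearMap.ker_comp, ← Submodule.disjoint_iff_comap_eq_bot]
  exact hC.disjoint.symm

lemma LinearMap.finrank_range_eq_of_isCompl_ker (A : V →ₗ[K] W) {C : Submodule K V}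
    (hC : IsCompl (LinearMap.ker A) C) :
    Module.finrank K (LinearMap.range A) = Module.finrank K C := by
  have h1 := A.finrank_range_add_finrank_ker
  have h2 := Submodule.finrank_add_eq_of_isCompl hC
  omega

/-- The rank of a member of a pencil of linear maps drops only finitely often. -/
lemma LinearMap.finite_finrank_range_add_smul_lt (A B : V →ₗ[K] W) :
    {ε : K | Module.finrank K (LinearMap.range (A + ε • B)) <
      Module.finrank K (LinearMap.range A)}.Finite := by
  obtain ⟨C, hC⟩ := (LinearMap.ker A).exists_isCompl
  refine (LinearMap.finite_not_injective_add_smul _ (B ∘ₗ C.subtype)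
    (A.injective_comp_subtype_of_isCompl_ker hC)).subset fun ε hε hinj => ?_
  have h1 := LinearMap.finrank_range_of_inj hinj
  have h2 : LinearMap.range (A ∘ₗ C.subtype + ε • B ∘ₗ C.subtype) ≤
      LinearMap.range (A + ε • B) := by
    rintro _ ⟨c, rfl⟩
    exact ⟨c, by simp⟩
  have h3 := Submodule.finrank_mono h2
  rw [Set.mem_ofPred_eq, A.finrank_range_eq_of_isCompl_ker hC] at hε
  omega

/-- If `A` has maximal rank in the pencil `A + ε B`, then `B` maps the kernel of `A` into the
range of `A`. -/
lemma LinearMap.apply_mem_range_of_finrank_range_le [Infinite K] (A B : V →ₗ[K] W)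
    (hmax : ∀ ε : K, Module.finrank K (LinearMap.range (A + ε • B)) ≤
      Module.finrank K (LinearMap.range A))
    {y : V} (hy : A y = 0) : B y ∈ LinearMap.range A := by
  by_contra hBy
  obtain ⟨C, hC⟩ := (LinearMap.ker A).exists_isCompl
  have hA := A.injective_comp_subtype_of_isCompl_ker hC
  let P : (C × K) →ₗ[K] W := (A ∘ₗ C.subtype).coprod (LinearMap.toSpanSingleton K W (B y))
  let Q : (C × K) →ₗ[K] W := (B ∘ₗ C.subtype).coprod 0
  have hP : Function.Injective P := by
    rw [← LinearMap.ker_eq_bot, LinearMap.ker_eq_bot']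
    rintro ⟨c, s⟩ h
    have h' : A c + s • B y = 0 := by simpa [P] using h
    have hs : s = 0 := by
      by_contra hs
      refine hBy ⟨-(s⁻¹ • (c : V)), ?_⟩
      rw [map_neg, map_smul, eq_neg_of_add_eq_zero_left h', smul_neg, neg_neg, inv_smul_smul₀ hs]
    subst hs
    have hc : c = 0 := hA (by simpa using h')
    rw [hc]
    rfl
  obtain ⟨ε, hε⟩ := ((LinearMap.finite_not_injective_add_smul P Q hP).union
    (Set.finite_singleton 0)).exists_notMem
  simp only [Set.mem_union, Set.mem_ofPred_eq, Set.mem_singleton_iff, not_or, not_not] at hε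
  obtain ⟨hinj, hε0⟩ := hε
  have h1 := LinearMap.finrank_range_of_inj hinj
  have h2 : LinearMap.range (P + ε • Q) ≤ LinearMap.range (A + ε • B) := by
    rintro _ ⟨⟨c, s⟩, rfl⟩
    refine ⟨c + (ε⁻¹ * s) • y, ?_⟩
    simp only [LinearMap.add_apply, LinearMap.smul_apply, map_add, map_smul, hy, P, Q,
      LinearMap.coprod_apply, LinearMap.comp_apply, Submodule.subtype_apply,
      LinearMap.toSpanSingleton_apply, LinearMap.zero_apply, smul_add, smul_smul,
      smul_zero]
    rw [mul_comm ε⁻¹, inv_mul_cancel_right₀ hε0]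
    abel
  have h3 := Submodule.finrank_mono h2
  have h4 := hmax ε
  rw [A.finrank_range_eq_of_isCompl_ker hC] at h4
  rw [Module.finrank_prod, Module.finrank_self] at h1
  omega

end LinearPencil

/-- Let `V` be a finite-dimensional subspace of a commutative algebra such that no nonzero element
of `V` is annihilated by `V`, squares of elements of `V` annihilated by `V` vanish, and the elements
of `V` with square zero lie on finitely many lines. Then multiplication by some element of `V` is
injective on `V`. -/
lemma Submodule.exists_mul_injOn {K R : Type*} [Field K] [Infinite K] [CommRing R] [Algebra K R]
    (V : Submodule K R) [FiniteDimensional K V]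
    (hV : ∀ w ∈ V, (∀ v ∈ V, v * w = 0) → w = 0)
    (hsq : ∀ y ∈ V, (∀ v ∈ V, v * (y * y) = 0) → y * y = 0)
    (b : Set R) (hb : b.Finite) (hbV : ∀ w ∈ b, w ∈ V ∧ w ≠ 0)
    (hlines : ∀ y ∈ V, y ≠ 0 → y * y = 0 → ∃ w ∈ b, ∃ c : K, y = c • w) :
    ∃ x ∈ V, ∀ y ∈ V, x * y = 0 → y = 0 := by
  by_contra! hcon
  let M : V →ₗ[K] V →ₗ[K] R := (LinearMap.mul K R).domRestrict₁₂ V V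
  obtain ⟨x, hx⟩ : ∃ x : V, ∀ x' : V, Module.finrank K (LinearMap.range (M x')) ≤
      Module.finrank K (LinearMap.range (M x)) := by
    have hbdd : BddAbove (Set.range fun x : V => Module.finrank K (LinearMap.range (M x))) := by
      refine ⟨Module.finrank K V, ?_⟩
      rintro _ ⟨x, rfl⟩
      exact LinearMap.finrank_range_le _
    obtain ⟨x, hx⟩ := Nat.sSup_mem (Set.range_nonempty _) hbdd
    exact ⟨x, fun x' => by simpa only [hx] using le_csSup hbdd ⟨x', rfl⟩⟩
  let ann : R → Submodule K V := fun w => LinearMap.ker ((LinearMap.mulRight K w) ∘ₗ V.subtype)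
  have hann : ∀ w (v : V), v ∈ ann w ↔ (v : R) * w = 0 := fun w v => by simp [ann]
  obtain ⟨x₁, hx₁⟩ : ∃ x₁ : V, ∀ w ∈ b, x₁ ∉ ann w := by
    classical
    have h := Subspace.biUnion_ne_univ_of_top_notMem (s := hb.toFinset.image ann) (by
      simp only [Finset.mem_image, Set.Finite.mem_toFinset, not_exists, not_and]
      intro w hw h
      refine (hbV w hw).2 (hV w (hbV w hw).1 fun v hv => ?_)
      have : (⟨v, hv⟩ : V) ∈ ann w := h ▸ Submodule.mem_top
      exact (hann w _).1 this)
    obtain ⟨x₁, hx₁⟩ := (Set.ne_univ_iff_exists_notMem _).1 h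
    refine ⟨x₁, fun w hw hmem => hx₁ ?_⟩
    simp only [Set.mem_iUnion]
    exact ⟨ann w, Finset.mem_image_of_mem _ (hb.mem_toFinset.2 hw), hmem⟩
  have hfin : (⋃ w ∈ b, {ε : K | x + ε • x₁ ∈ ann w}).Finite := by
    refine hb.biUnion fun w hw => Set.Subsingleton.finite fun ε hε δ hδ => ?_
    by_contra hne
    have h : (ε - δ) • x₁ ∈ ann w := by
      have h' : (ε - δ) • x₁ = (x + ε • x₁) - (x + δ • x₁) := by module
      exact h' ▸ (ann w).sub_mem hε hδ
    exact hx₁ w hw (((ann w).smul_mem_iff (sub_ne_zero.2 hne)).1 h)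
  obtain ⟨ε, hε⟩ := (hfin.union
    (LinearMap.finite_finrank_range_add_smul_lt (M x) (M x₁))).exists_notMem
  simp only [Set.mem_union, Set.mem_iUnion, Set.mem_ofPred_eq, not_or, not_exists, not_lt] at hε
  obtain ⟨hε1, hε2⟩ := hε
  set x₂ := x + ε • x₁ with hx₂
  have hmax : ∀ x' : V, Module.finrank K (LinearMap.range (M x')) ≤
      Module.finrank K (LinearMap.range (M x₂)) := fun x' => by
    rw [hx₂, map_add, map_smul]
    exact (hx x').trans hε2
  obtain ⟨y, hyV, hxy, hy0⟩ := hcon x₂ x₂.2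
  have hyy : y * y = 0 := by
    refine hsq y hyV fun v hv => ?_
    obtain ⟨u, hu⟩ := LinearMap.apply_mem_range_of_finrank_range_le (M x₂) (M ⟨v, hv⟩)
      (fun δ => by
        rw [← map_smul, ← map_add]
        exact hmax _)
      (y := ⟨y, hyV⟩) hxy
    have hu' : (x₂ : R) * u = v * y := hu
    linear_combination (-y) * hu' + (u : R) * hxy
  obtain ⟨w, hw, c, rfl⟩ := hlines y hyV hy0 hyy
  have hc : c ≠ 0 := by
    rintro rfl
    exact hy0 (zero_smul _ _)
  rw [mul_smul_comm, smul_eq_zero_iff_right hc] at hxy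
  exact hε1 w hw ((hann w _).2 hxy)

section Sequence

open RingTheory.Sequence

/-- Every coefficient of a syzygy of a weakly regular sequence lies in the ideal generated by the
sequence. -/
lemma RingTheory.Sequence.IsWeaklyRegular.mem_span_of_sum_mul_eq_zero {A : Type*} [CommRing A]
    {m : ℕ} {f : Fin m → A} (hf : IsWeaklyRegular A (List.ofFn f)) (g : Fin m → A)
    (hg : ∑ j, g j * f j = 0) (j : Fin m) : g j ∈ Ideal.span (Set.range f) := by
  induction m with
  | zero => exact j.elim0
  | succ m ih =>
    rw [List.ofFn_succ', List.concat_eq_append, isWeaklyRegular_append_iff] at hf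
    obtain ⟨hf₁, hf₂⟩ := hf
    rw [isWeaklyRegular_singleton_iff] at hf₂
    have hspan : (Ideal.ofList (List.ofFn fun i : Fin m => f i.castSucc) • ⊤ : Submodule A A) =
        Ideal.span (Set.range fun i : Fin m => f i.castSucc) := by
      rw [smul_eq_mul, Ideal.mul_top, Ideal.ofList]
      congr 1
      ext x
      simp [List.mem_ofFn]
    have hle : Ideal.span (Set.range fun i : Fin m => f i.castSucc) ≤ Ideal.span (Set.range f) :=
      Ideal.span_mono (by rintro _ ⟨i, rfl⟩; exact ⟨_, rfl⟩)
    rw [Fin.sum_univ_castSucc] at hg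
    have hlast : g (Fin.last m) ∈ Ideal.span (Set.range fun i : Fin m => f i.castSucc) := by
      rw [← hspan, ← Submodule.Quotient.mk_eq_zero]
      apply hf₂
      simp only [smul_zero]
      rw [← Submodule.Quotient.mk_smul, Submodule.Quotient.mk_eq_zero, hspan, smul_eq_mul, mul_comm,
        eq_neg_of_add_eq_zero_right hg]
      exact neg_mem (sum_mem fun i _ => Ideal.mul_mem_left _ _ (Ideal.subset_span ⟨i, rfl⟩))
    obtain ⟨h, hh⟩ := Ideal.mem_span_range_iff_exists_fun.1 hlast
    refine Fin.lastCases (hle hlast) (fun i => ?_) j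
    have hi := ih hf₁ (fun i => g i.castSucc + h i * f (Fin.last m)) (by
      rw [← hh, Finset.sum_mul] at hg
      rw [← hg, ← Finset.sum_add_distrib]
      exact Finset.sum_congr rfl fun i _ => by ring) i
    have := sub_mem (hle hi) (Ideal.mul_mem_left (Ideal.span (Set.range f)) (h i)
      (Ideal.subset_span ⟨Fin.last m, rfl⟩))
    simpa using this

/-- A polynomial relation with coefficients in a field `K`, evaluated at a regular sequence on `M`,
annihilates `M` only if it is trivial. -/
lemma RingTheory.Sequence.IsRegular.eq_zero_of_aeval_smul_eq_zero {K A : Type*} [Field K]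
    [CommRing A] [Algebra K A] {m : ℕ} {M : Type*} [AddCommGroup M] [Module A M] {f : Fin m → A}
    (hf : IsRegular M (List.ofFn f)) (F : MvPolynomial (Fin m) K)
    (hF : ∀ x : M, MvPolynomial.aeval f F • x = 0) : F = 0 := by
  induction m generalizing M with
  | zero =>
    have := hf.nontrivial
    rw [F.eq_C_of_isEmpty] at hF ⊢
    by_contra hne
    have hc : IsUnit (algebraMap K A (F.coeff 0)) :=
      (IsUnit.mk0 _ fun h => hne (by rw [h, map_zero])).map _
    obtain ⟨x, hx⟩ := exists_ne (0 : M)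
    refine hx ?_
    have := hF x
    rwa [MvPolynomial.aeval_C, hc.smul_eq_zero] at this
  | succ m ih =>
    rw [List.ofFn_succ, isRegular_cons_iff] at hf
    obtain ⟨hreg, hf⟩ := hf
    let φ : MvPolynomial (Fin m) K →ₐ[K] A := MvPolynomial.aeval fun i => f i.succ
    have hφ : ∀ i, φ (MvPolynomial.X i) = f i.succ := fun i => MvPolynomial.aeval_X _ _
    have hzero : ∀ p : Polynomial (MvPolynomial (Fin m) K),
        (∀ x : M, p.eval₂ φ.toRingHom (f 0) • x = 0) → p.coeff 0 = 0 := by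
      intro p hp
      refine ih hf _ fun x => ?_
      obtain ⟨x, rfl⟩ := Submodule.Quotient.mk_surjective _ x
      rw [← Submodule.Quotient.mk_smul, Submodule.Quotient.mk_eq_zero]
      have h := hp x
      rw [← p.X_mul_divX_add, Polynomial.eval₂_add, Polynomial.eval₂_mul, Polynomial.eval₂_X,
        Polynomial.eval₂_C, add_smul, mul_smul] at h
      have h' : φ (p.coeff 0) • x = f 0 • -(p.divX.eval₂ φ.toRingHom (f 0) • x) := by
        rw [smul_neg]
        exact eq_neg_of_add_eq_zero_right h
      exact h' ▸ Submodule.smul_mem_pointwise_smul _ _ _ Submodule.mem_top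
    have hcoeff : ∀ (k : ℕ) (p : Polynomial (MvPolynomial (Fin m) K)),
        (∀ x : M, p.eval₂ φ.toRingHom (f 0) • x = 0) → p.coeff k = 0 := by
      intro k
      induction k with
      | zero => exact hzero
      | succ k ihk =>
        intro p hp
        rw [← Polynomial.coeff_divX]
        refine ihk _ fun x => hreg ?_
        have h := hp x
        rw [← p.X_mul_divX_add, hzero p hp, map_zero, add_zero, Polynomial.eval₂_mul,
          Polynomial.eval₂_X, mul_smul] at h
        simpa using h
    have haeval : ∀ F : MvPolynomial (Fin (m + 1)) K, MvPolynomial.aeval f F =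
        ((MvPolynomial.finSuccEquiv K m) F).eval₂ φ.toRingHom (f 0) := by
      intro F
      induction F using MvPolynomial.induction_on with
      | C a =>
        rw [← MvPolynomial.algebraMap_eq, AlgHom.commutes, AlgEquiv.commutes,
          IsScalarTower.algebraMap_apply K (MvPolynomial (Fin m) K) (Polynomial _),
          Polynomial.algebraMap_eq, Polynomial.eval₂_C]
        exact (φ.commutes a).symm
      | add p q hp hq => rw [map_add, map_add, Polynomial.eval₂_add, hp, hq]
      | mul_X p i hp =>
        rw [map_mul, map_mul, Polynomial.eval₂_mul, hp, MvPolynomial.aeval_X]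
        congr 1
        refine Fin.cases ?_ (fun i => ?_) i
        · rw [MvPolynomial.finSuccEquiv_X_zero, Polynomial.eval₂_X]
        · rw [MvPolynomial.finSuccEquiv_X_succ, Polynomial.eval₂_C]
          exact (hφ i).symm
    apply (MvPolynomial.finSuccEquiv K m).injective
    rw [map_zero]
    ext1 k
    rw [Polynomial.coeff_zero]
    refine hcoeff k _ fun x => ?_
    rw [← haeval]
    exact hF x

lemma RingTheory.Sequence.IsRegular.algebraicIndependent {K A : Type*} [Field K] [CommRing A]
    [Algebra K A] {m : ℕ} {f : Fin m → A} (hf : IsRegular A (List.ofFn f)) :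
    AlgebraicIndependent K f :=
  algebraicIndependent_iff.2 fun F hF => hf.eq_zero_of_aeval_smul_eq_zero F fun x => by
    rw [hF, zero_smul]

end Sequence

/-- Linearly independent elements of the linear span of an algebraically independent family are
algebraically independent. -/
lemma AlgebraicIndependent.of_linearIndependent_of_mem_span {ι κ K A : Type*} [Finite ι] [Field K]
    [CommRing A] [Algebra K A] {f : ι → A} (hf : AlgebraicIndependent K f) {g : κ → A}
    (hg : LinearIndependent K g) (hgf : ∀ i, g i ∈ Submodule.span K (Set.range f)) :
    AlgebraicIndependent K g := by
  have := Fintype.ofFinite ι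
  choose a ha using fun i => (Submodule.mem_span_range_iff_exists_fun K).1 (hgf i)
  have hali : LinearIndependent K a := by
    refine LinearIndependent.of_comp (Fintype.linearCombination K f) ?_
    convert hg using 1
    ext i
    exact ha i
  obtain ⟨B, hB⟩ := (Finsupp.linearCombination K a).exists_leftInverse_of_injective
    (LinearMap.ker_eq_bot.2 hali)
  have hBa : ∀ i, B (a i) = Finsupp.single i 1 := fun i => by
    simpa using LinearMap.congr_fun hB (Finsupp.single i 1)
  classical
  let ψ : MvPolynomial κ K →ₐ[K] MvPolynomial ι K :=
    MvPolynomial.aeval fun i => ∑ j, a i j • MvPolynomial.X j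
  let χ : MvPolynomial ι K →ₐ[K] MvPolynomial κ K :=
    MvPolynomial.aeval fun j =>
      Finsupp.linearCombination K MvPolynomial.X (B (Pi.single j 1))
  have hχψ : χ.comp ψ = AlgHom.id K _ := by
    ext1 i
    have h : a i = ∑ j, a i j • Pi.single j (1 : K) := pi_eq_sum_univ' (a i)
    have h' := congrArg (Finsupp.linearCombination K (MvPolynomial.X (R := K))) (hBa i)
    rw [h] at h'
    simpa [ψ, χ] using h'
  have hcomp : MvPolynomial.aeval g = (MvPolynomial.aeval f).comp ψ := by
    ext1 i
    simp [ψ, ha]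
  rw [algebraicIndependent_iff_injective_aeval, hcomp]
  rw [AlgHom.coe_comp]
  exact Function.Injective.comp (algebraicIndependent_iff_injective_aeval.1 hf)
    (Function.LeftInverse.injective (g := χ) fun p => AlgHom.congr_fun hχψ p)

/-- The squares of the variables together with the square of a linear form involving at least two
variables are linearly independent. -/
lemma MvPolynomial.linearIndependent_sq_X_option {κ K : Type*} [Fintype κ] [Field K] [CharZero K]
    (a : κ → K) {i j : κ} (hij : i ≠ j) (hi : a i ≠ 0) (hj : a j ≠ 0) :
    LinearIndependent K fun o : Option κ =>
      o.elim ((∑ l, C (a l) * X l) ^ 2 : MvPolynomial κ K) fun l => X l ^ 2 := by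
  classical
  rw [Fintype.linearIndependent_iff]
  intro c hc
  have hv : ∀ v : κ → K, c none * (∑ l, a l * v l) ^ 2 + ∑ l, c (some l) * v l ^ 2 = 0 := by
    intro v
    simpa [Fintype.sum_option, smul_eval] using congrArg (eval v) hc
  have hsingle : ∀ l, c none * a l ^ 2 + c (some l) = 0 := fun l => by
    simpa [Pi.single_apply] using hv (Pi.single l 1)
  have hnone : c none = 0 := by
    have h := hv (Pi.single i 1 + Pi.single j 1)
    have h1 : ∑ l, a l * (Pi.single i 1 + Pi.single j 1 : κ → K) l = a i + a j := by
      simp [mul_add, Finset.sum_add_distrib, Pi.single_apply]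
    have h2 : ∑ l, c (some l) * (Pi.single i 1 + Pi.single j 1 : κ → K) l ^ 2 =
        c (some i) + c (some j) := by
      have : ∀ l, c (some l) * (Pi.single i 1 + Pi.single j 1 : κ → K) l ^ 2 =
          c (some l) * (Pi.single i 1 : κ → K) l + c (some l) * (Pi.single j 1 : κ → K) l := by
        intro l
        by_cases hli : l = i
        · subst hli
          simp [hij]
        · by_cases hlj : l = j
          · subst hlj
            simp [hli]
          · simp [hli, hlj]
      rw [Finset.sum_congr rfl fun l _ => this l]
      simp [Finset.sum_add_distrib, Pi.single_apply]
    rw [h1, h2] at h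
    have : 2 * (a i * a j) * c none = 0 := by
      linear_combination h - hsingle i - hsingle j
    exact (mul_eq_zero.1 this).resolve_left (mul_ne_zero two_ne_zero (mul_ne_zero hi hj))
  rintro (_ | l)
  · exact hnone
  · simpa [hnone] using hsingle l

/-- Suppose that the squares of linearly independent linear forms `w l` lie in the span of an
algebraically independent family. If the square of a linear combination of the `w l` lies there
too, then at most one of its coefficients is nonzero. -/
lemma MvPolynomial.eq_zero_of_sq_mem_span {σ κ ι K : Type*} [Finite ι] [Finite σ] [Fintype κ]
    [Field K] [CharZero K] {f : ι → MvPolynomial σ K} (hf : AlgebraicIndependent K f)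
    {w : κ → MvPolynomial σ K} (hw : LinearIndependent K w) (hw1 : ∀ l, (w l).IsHomogeneous 1)
    (hwf : ∀ l, w l ^ 2 ∈ Submodule.span K (Set.range f)) (a : κ → K)
    (haf : (∑ l, a l • w l) ^ 2 ∈ Submodule.span K (Set.range f)) {i j : κ} (hij : i ≠ j)
    (hi : a i ≠ 0) : a j = 0 := by
  by_contra hj
  have hwalg : AlgebraicIndependent K w :=
    (MvPolynomial.algebraicIndependent_X σ K).of_linearIndependent_of_mem_span hw fun l => by
      rw [← homogeneousSubmodule_one_eq_span_X]
      exact hw1 l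
  have hlin := (linearIndependent_sq_X_option a hij hi hj).map' (aeval w).toLinearMap
    (LinearMap.ker_eq_bot.2 (algebraicIndependent_iff_injective_aeval.1 hwalg))
  have heq : (aeval w).toLinearMap ∘ (fun o : Option κ =>
      o.elim ((∑ l, C (a l) * X l) ^ 2 : MvPolynomial κ K) fun l => X l ^ 2) =
      fun o : Option κ => o.elim ((∑ l, a l • w l) ^ 2) fun l => w l ^ 2 := by
    ext1 o
    cases o <;> simp [Algebra.smul_def, algebraMap_eq]
  rw [heq] at hlin
  have halg := hf.of_linearIndependent_of_mem_span hlin (by rintro (_ | l); exacts [haf, hwf l])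
  obtain ⟨-, htr⟩ := AlgebraicIndependent.option_iff.1 halg
  have hint : ∀ l, IsIntegral (Algebra.adjoin K (Set.range fun l => w l ^ 2)) (w l) := fun l => by
    refine IsIntegral.of_pow (n := 2) two_pos ?_
    exact isIntegral_algebraMap (x := (⟨w l ^ 2, Algebra.subset_adjoin ⟨l, rfl⟩⟩ :
      Algebra.adjoin K (Set.range fun l => w l ^ 2)))
  refine htr (IsIntegral.isAlgebraic (IsIntegral.pow (IsIntegral.sum _ fun l _ => ?_) 2))
  exact (hint l).smul (a l)

namespace MvPolynomial

variable {σ ι K : Type*} [Fintype ι] [Field K] {f : ι → MvPolynomial σ K}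

section Homogeneous

variable {e : ℕ}

attribute [local instance] MvPolynomial.gradedAlgebra

lemma homogeneousComponent_mul_of_isHomogeneous (d : ℕ) (p : MvPolynomial σ K)
    {q : MvPolynomial σ K} (hq : q.IsHomogeneous e) :
    homogeneousComponent (d + e) (p * q) = homogeneousComponent d p * q := by
  have h := DirectSum.coe_decompose_mul_of_right_mem_of_le (homogeneousSubmodule σ K) (a := p)
    (n := d + e) hq (Nat.le_add_left e d)
  rw [Nat.add_sub_cancel] at h
  rw [← decomposition.decompose'_apply, ← decomposition.decompose'_apply]
  exact h

lemma homogeneousComponent_mul_of_isHomogeneous_of_lt {d : ℕ} (p : MvPolynomial σ K)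
    {q : MvPolynomial σ K} (hq : q.IsHomogeneous e) (hd : d < e) :
    homogeneousComponent d (p * q) = 0 := by
  have h := DirectSum.coe_decompose_mul_of_right_mem_of_not_le (homogeneousSubmodule σ K) (a := p)
    (n := d) hq (not_le.2 hd)
  rw [← decomposition.decompose'_apply]
  exact h

end Homogeneous

/-- A form in an ideal generated by forms of degree `e` is a combination of the generators with
homogeneous coefficients. -/
lemma exists_isHomogeneous_sum_eq_of_mem_span {e d : ℕ} (hf : ∀ i, (f i).IsHomogeneous e)
    {p : MvPolynomial σ K} (hp : p.IsHomogeneous (d + e)) (hpf : p ∈ Ideal.span (Set.range f)) :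
    ∃ a : ι → MvPolynomial σ K, (∀ i, (a i).IsHomogeneous d) ∧ ∑ i, a i * f i = p := by
  obtain ⟨c, hc⟩ := Ideal.mem_span_range_iff_exists_fun.1 hpf
  refine ⟨fun i => homogeneousComponent d (c i), fun i => homogeneousComponent_isHomogeneous _ _,
    ?_⟩
  have h := congrArg (homogeneousComponent (d + e)) hc
  rw [map_sum, (homogeneousComponent_of_mem hp).trans (if_pos rfl)] at h
  rw [← h]
  exact Finset.sum_congr rfl fun i _ => (homogeneousComponent_mul_of_isHomogeneous d _ (hf i)).symm

lemma eq_zero_of_mem_span_of_lt {e d : ℕ} (hf : ∀ i, (f i).IsHomogeneous e)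
    {p : MvPolynomial σ K} (hp : p.IsHomogeneous d) (hd : d < e)
    (hpf : p ∈ Ideal.span (Set.range f)) : p = 0 := by
  obtain ⟨c, hc⟩ := Ideal.mem_span_range_iff_exists_fun.1 hpf
  have h := congrArg (homogeneousComponent d) hc
  rw [map_sum, (homogeneousComponent_of_mem hp).trans (if_pos rfl)] at h
  rw [← h]
  exact Finset.sum_eq_zero fun i _ => homogeneousComponent_mul_of_isHomogeneous_of_lt _ (hf i) hd

lemma exists_sum_C_mul_eq_of_mem_span {e : ℕ} (hf : ∀ i, (f i).IsHomogeneous e)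
    {p : MvPolynomial σ K} (hp : p.IsHomogeneous e) (hpf : p ∈ Ideal.span (Set.range f)) :
    ∃ a : ι → K, ∑ i, C (a i) * f i = p := by
  obtain ⟨a, ha, h⟩ := exists_isHomogeneous_sum_eq_of_mem_span hf (d := 0)
    (by rwa [Nat.zero_add]) hpf
  have hC : ∀ i, ∃ c, C c = a i := fun i => by
    have := totalDegree_eq_zero_iff_eq_C.1 ((totalDegree_zero_iff_isHomogeneous σ).2 (ha i))
    exact ⟨_, this.symm⟩
  choose c hc using hC
  exact ⟨c, by simpa only [hc] using h⟩

lemma mem_span_of_isHomogeneous_of_mem_ideal_span {e : ℕ} (hf : ∀ i, (f i).IsHomogeneous e)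
    {p : MvPolynomial σ K} (hp : p.IsHomogeneous e) (hpf : p ∈ Ideal.span (Set.range f)) :
    p ∈ Submodule.span K (Set.range f) := by
  obtain ⟨a, ha⟩ := exists_sum_C_mul_eq_of_mem_span hf hp hpf
  exact (Submodule.mem_span_range_iff_exists_fun K).2 ⟨a, by simpa only [smul_eq_C_mul] using ha⟩

section Socle

variable (hf : ∀ i, (f i).IsHomogeneous 2)
  (hsyz : ∀ g : ι → MvPolynomial σ K, ∑ j, g j * f j = 0 → ∀ j, g j ∈ Ideal.span (Set.range f))

include hf hsyz

/-- The coefficients of a linear syzygy of quadrics with only trivial syzygies vanish. -/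
lemma eq_zero_of_sum_mul_eq_zero {g : ι → MvPolynomial σ K} (hg1 : ∀ j, (g j).IsHomogeneous 1)
    (hg : ∑ j, g j * f j = 0) (j : ι) : g j = 0 :=
  eq_zero_of_mem_span_of_lt hf (hg1 j) one_lt_two (hsyz g hg j)

/-- The quotient by quadrics with only trivial syzygies has no socle in degree one. -/
lemma eq_zero_of_X_mul_mem_span [Nontrivial σ] {w : MvPolynomial σ K} (hw1 : w.IsHomogeneous 1)
    (hw : ∀ i, X i * w ∈ Ideal.span (Set.range f)) : w = 0 := by
  obtain ⟨i, k, hik⟩ := exists_pair_ne σ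
  choose c hc using fun i =>
    exists_sum_C_mul_eq_of_mem_span hf ((isHomogeneous_X K i).mul hw1) (hw i)
  have h : ∀ j, X k * C (c i j) - X i * C (c k j) = 0 := by
    refine eq_zero_of_sum_mul_eq_zero hf hsyz (fun j => ?_) ?_
    · exact ((isHomogeneous_X K k).mul (isHomogeneous_C σ _)).sub
        ((isHomogeneous_X K i).mul (isHomogeneous_C σ _))
    · have : ∀ j, (X k * C (c i j) - X i * C (c k j)) * f j =
          X k * (C (c i j) * f j) - X i * (C (c k j) * f j) := fun j => by ring
      simp_rw [this]
      rw [Finset.sum_sub_distrib, ← Finset.mul_sum, ← Finset.mul_sum, hc, hc]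
      ring
  have hci : ∀ j, c i j = 0 := fun j => by
    classical
    simpa [hik] using congrArg (eval (Pi.single k 1)) (h j)
  have h0 := hc i
  simp only [hci, map_zero, zero_mul, Finset.sum_const_zero] at h0
  exact (mul_eq_zero.1 h0.symm).resolve_left (X_ne_zero i)

/-- In at least three variables, the quotient by quadrics with only trivial syzygies has no socle
in degree two. -/
lemma mem_span_of_X_mul_mem_span {i k p : σ} (hik : i ≠ k) (hip : i ≠ p) (hkp : k ≠ p)
    {z : MvPolynomial σ K} (hz2 : z.IsHomogeneous 2)
    (hz : ∀ i, X i * z ∈ Ideal.span (Set.range f)) : z ∈ Ideal.span (Set.range f) := by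
  choose l hl1 hl using fun i => exists_isHomogeneous_sum_eq_of_mem_span (d := 1) hf
    ((isHomogeneous_X K i).mul hz2) (hz i)
  have hmem : ∀ i k j, X k * l i j - X i * l k j ∈ Ideal.span (Set.range f) := by
    intro i k
    refine hsyz _ ?_
    have : ∀ j, (X k * l i j - X i * l k j) * f j =
        X k * (l i j * f j) - X i * (l k j * f j) := fun j => by ring
    simp_rw [this]
    rw [Finset.sum_sub_distrib, ← Finset.mul_sum, ← Finset.mul_sum, hl, hl]
    ring
  choose c hc using fun i k j => exists_sum_C_mul_eq_of_mem_span hf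
    (((isHomogeneous_X K k).mul (hl1 i j)).sub ((isHomogeneous_X K i).mul (hl1 k j))) (hmem i k j)
  have hrel : ∀ j m, X p * C (c i k j m) + X i * C (c k p j m) + X k * C (c p i j m) = 0 := by
    intro j
    refine eq_zero_of_sum_mul_eq_zero hf hsyz (fun m => ?_) ?_
    · exact (((isHomogeneous_X K p).mul (isHomogeneous_C σ _)).add
        ((isHomogeneous_X K i).mul (isHomogeneous_C σ _))).add
        ((isHomogeneous_X K k).mul (isHomogeneous_C σ _))
    · have : ∀ m, (X p * C (c i k j m) + X i * C (c k p j m) + X k * C (c p i j m)) * f m =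
          X p * (C (c i k j m) * f m) + X i * (C (c k p j m) * f m) +
            X k * (C (c p i j m) * f m) := fun j => by ring
      simp_rw [this]
      rw [Finset.sum_add_distrib, Finset.sum_add_distrib, ← Finset.mul_sum, ← Finset.mul_sum,
        ← Finset.mul_sum, hc, hc, hc]
      ring
  have hcik : ∀ j m, c i k j m = 0 := fun j m => by
    classical
    simpa [hip, hkp] using congrArg (eval (Pi.single p 1)) (hrel j m)
  have hdvd : ∀ j, X i ∣ l i j := fun j => by
    have h := hc i k j
    simp only [hcik, map_zero, zero_mul, Finset.sum_const_zero] at h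
    exact ((X_prime (i := i)).dvd_or_dvd ⟨l k j, sub_eq_zero.1 h.symm⟩).resolve_left
      fun h => hik (X_dvd_X.1 h)
  choose a ha using hdvd
  have hza : z = ∑ j, a j * f j := by
    refine mul_left_cancel₀ (X_ne_zero (R := K) i) ?_
    rw [← hl i, Finset.mul_sum]
    exact Finset.sum_congr rfl fun j _ => by rw [ha j, mul_assoc]
  rw [hza]
  exact sum_mem fun j _ => Ideal.mul_mem_left _ _ (Ideal.subset_span ⟨j, rfl⟩)

end Socle

lemma homogeneousSubmodule_two_le_span_sym2 {σ K : Type*} [CommSemiring K] :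
    homogeneousSubmodule σ K 2 ≤
      Submodule.span K (Set.range fun s : Sym2 σ => (s.map (X (R := K))).mul) := by
  rw [← homogeneousSubmodule_one_pow, homogeneousSubmodule_one_eq_span_X, pow_two,
    Submodule.span_mul_span]
  refine Submodule.span_mono ?_
  rintro _ ⟨_, ⟨i, rfl⟩, _, ⟨j, rfl⟩, rfl⟩
  exact ⟨s(i, j), rfl⟩

lemma finrank_homogeneousSubmodule_two_le {σ K : Type*} [Fintype σ] [Field K] :
    Module.finrank K (homogeneousSubmodule σ K 2) ≤ (Fintype.card σ + 1).choose 2 := by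
  classical
  rw [← Sym2.card]
  have := Module.Finite.span_of_finite K
    (Set.finite_range fun s : Sym2 σ => (s.map (X (R := K))).mul)
  exact (Submodule.finrank_mono homogeneousSubmodule_two_le_span_sym2).trans
    (finrank_range_le_card _)

/-- A subspace containing the squares of all linear forms contains all quadrics. -/
lemma homogeneousSubmodule_two_le_of_sq_mem {σ K : Type*} [Field K] [CharZero K]
    {Q : Submodule K (MvPolynomial σ K)} (hQ : ∀ x : MvPolynomial σ K, x.IsHomogeneous 1 →
      x ^ 2 ∈ Q) : homogeneousSubmodule σ K 2 ≤ Q := by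
  refine homogeneousSubmodule_two_le_span_sym2.trans (Submodule.span_le.2 ?_)
  rintro _ ⟨⟨i, j⟩, rfl⟩
  have hi := hQ _ (isHomogeneous_X K i)
  have hj := hQ _ (isHomogeneous_X K j)
  have hij := hQ _ ((isHomogeneous_X K i).add (isHomogeneous_X K j))
  have h := Q.sub_mem (Q.sub_mem hij hi) hj
  have h2 : (X i + X j) ^ 2 - X i ^ 2 - X j ^ 2 = (2 : K) • (X i * X j : MvPolynomial σ K) := by
    rw [two_smul]
    ring
  rw [h2] at h
  exact (Q.smul_mem_iff two_ne_zero).1 h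

end MvPolynomial

lemma mem_gradedPiece_iff {K : Type*} [Field K] {n : ℕ} {I : Ideal (MvPolynomial (Fin n) K)}
    {i : ℕ} {x : MvPolynomial (Fin n) K ⧸ I} :
    x ∈ gradedPiece I i ↔
      ∃ p : MvPolynomial (Fin n) K, p.IsHomogeneous i ∧ Ideal.Quotient.mk I p = x :=
  Iff.rfl

section Quadrics

open MvPolynomial

variable {K : Type*} [Field K] [CharZero K] {n : ℕ}
  {f : Fin (n + 1) → MvPolynomial (Fin (n + 1)) K}

/-- The linear forms with square zero modulo an ideal generated by algebraically independent
quadrics lie on finitely many lines. -/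
lemma MvPolynomial.exists_finite_lines_of_sq_mem_span (hf : ∀ i, (f i).IsHomogeneous 2)
    (halg : AlgebraicIndependent K f) :
    ∃ b : Set (MvPolynomial (Fin (n + 1)) K), b.Finite ∧ (∀ w ∈ b, w.IsHomogeneous 1 ∧ w ≠ 0) ∧
      ∀ y : MvPolynomial (Fin (n + 1)) K, y.IsHomogeneous 1 → y ≠ 0 →
        y ^ 2 ∈ Ideal.span (Set.range f) → ∃ w ∈ b, ∃ c : K, y = c • w := by
  obtain ⟨b, hbY, hspan, hli⟩ := exists_linearIndependent K
    {y : MvPolynomial (Fin (n + 1)) K | y.IsHomogeneous 1 ∧ y ^ 2 ∈ Ideal.span (Set.range f)}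
  have hsq : ∀ y : MvPolynomial (Fin (n + 1)) K, y.IsHomogeneous 1 →
      y ^ 2 ∈ Ideal.span (Set.range f) → y ^ 2 ∈ Submodule.span K (Set.range f) := fun y hy hyf =>
    mem_span_of_isHomogeneous_of_mem_ideal_span hf (hy.pow 2) hyf
  have hfin : Finite b := by
    have : Module.Finite K (homogeneousSubmodule (Fin (n + 1)) K 1) :=
      Module.Finite.iff_fg.2 (homogeneousSubmodule_fg _ _ 1)
    have hli' : LinearIndependent K
        fun w : b => (⟨w, (hbY w.2).1⟩ : homogeneousSubmodule (Fin (n + 1)) K 1) :=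
      LinearIndependent.of_comp (Submodule.subtype _) hli
    exact hli'.finite
  have := Fintype.ofFinite b
  refine ⟨b, hfin, fun w hw => ⟨(hbY hw).1, hli.ne_zero ⟨w, hw⟩⟩, fun y hy hy0 hyf => ?_⟩
  have hyb : y ∈ Submodule.span K (Set.range ((↑) : b → MvPolynomial (Fin (n + 1)) K)) := by
    rw [Subtype.range_coe, hspan]
    exact Submodule.subset_span ⟨hy, hyf⟩
  obtain ⟨a, rfl⟩ := (Submodule.mem_span_range_iff_exists_fun K).1 hyb
  obtain ⟨i, -, hi⟩ := Finset.exists_ne_zero_of_sum_ne_zero hy0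
  have hai : a i ≠ 0 := left_ne_zero_of_smul hi
  refine ⟨i, i.2, a i, Finset.sum_eq_single i (fun j _ hji => ?_) (by simp)⟩
  rw [eq_zero_of_sq_mem_span halg hli (fun l => (hbY l.2).1)
    (fun l => hsq _ (hbY l.2).1 (hbY l.2).2) a (hsq _ hy hyf) hji.symm hai, zero_smul]

/-- In at most two variables, multiplication by a suitable linear form maps onto the degree-two
piece of the quotient by algebraically independent quadrics. -/
lemma exists_mul_surjOn_gradedPiece_two (hn : n ≤ 1) (hf : ∀ i, (f i).IsHomogeneous 2)
    (halg : AlgebraicIndependent K f) :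
    ∃ x ∈ gradedPiece (Ideal.span (Set.range f)) 1,
      ∀ z ∈ gradedPiece (Ideal.span (Set.range f)) 2,
        ∃ y ∈ gradedPiece (Ideal.span (Set.range f)) 1, x * y = z := by
  set Q := Submodule.span K (Set.range f) with hQ
  have hfin : Module.Finite K (homogeneousSubmodule (Fin (n + 1)) K 2) :=
    Module.Finite.iff_fg.2 (homogeneousSubmodule_fg _ _ 2)
  obtain ⟨x, hx1, hx⟩ : ∃ x : MvPolynomial (Fin (n + 1)) K, x.IsHomogeneous 1 ∧
      homogeneousSubmodule (Fin (n + 1)) K 2 ≤ Q ⊔ Submodule.span K {x ^ 2} := by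
    by_cases h : ∀ x : MvPolynomial (Fin (n + 1)) K, x.IsHomogeneous 1 → x ^ 2 ∈ Q
    · exact ⟨0, isHomogeneous_zero _ _ _,
        (homogeneousSubmodule_two_le_of_sq_mem h).trans le_sup_left⟩
    push Not at h
    obtain ⟨x, hx1, hx⟩ := h
    refine ⟨x, hx1, ?_⟩
    have hle : Q ⊔ Submodule.span K {x ^ 2} ≤ homogeneousSubmodule (Fin (n + 1)) K 2 := by
      refine sup_le (Submodule.span_le.2 ?_) ((Submodule.span_singleton_le_iff_mem _ _).2 ?_)
      · rintro _ ⟨i, rfl⟩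
        exact hf i
      · exact hx1.pow 2
    refine (Submodule.eq_of_le_of_finrank_le hle ?_).ge
    have hQfin : Module.Finite K Q := Module.Finite.span_of_finite K (Set.finite_range f)
    have hQcard : Module.finrank K Q = n + 1 := by
      rw [hQ, finrank_span_eq_card halg.linearIndependent, Fintype.card_fin]
    have hlt : Q < Q ⊔ Submodule.span K {x ^ 2} :=
      lt_of_le_of_ne le_sup_left fun h => hx (h.symm ▸
        Submodule.mem_sup_right (Submodule.mem_span_singleton_self _))
    have h1 := Submodule.finrank_lt_finrank_of_lt hlt
    have h2 := finrank_homogeneousSubmodule_two_le (σ := Fin (n + 1)) (K := K)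
    rw [Fintype.card_fin] at h2
    have h3 : (n + 1 + 1).choose 2 ≤ n + 2 := by
      interval_cases n <;> decide
    omega
  refine ⟨_, mem_gradedPiece_iff.2 ⟨x, hx1, rfl⟩, fun z hz => ?_⟩
  obtain ⟨z, hz2, rfl⟩ := mem_gradedPiece_iff.1 hz
  obtain ⟨q, hq, r, hr, rfl⟩ := Submodule.mem_sup.1 (hx hz2)
  obtain ⟨c, rfl⟩ := Submodule.mem_span_singleton.1 hr
  refine ⟨_, mem_gradedPiece_iff.2 ⟨c • x, (homogeneousSubmodule _ K 1).smul_mem c hx1, rfl⟩, ?_⟩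
  have hqI : q ∈ Ideal.span (Set.range f) :=
    Submodule.span_le_restrictScalars K (MvPolynomial (Fin (n + 1)) K) _ hq
  rw [← map_mul, map_add, Ideal.Quotient.eq_zero_iff_mem.2 hqI, zero_add, mul_smul_comm, pow_two]

/-- In at least three variables, multiplication by a suitable linear form is injective on the
degree-one piece of the quotient by a regular sequence of quadrics. -/
lemma exists_mul_injOn_gradedPiece_one (hn : 2 ≤ n) (hf : ∀ i, (f i).IsHomogeneous 2)
    (hreg : RingTheory.Sequence.IsRegular (MvPolynomial (Fin (n + 1)) K) (List.ofFn f)) :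
    ∃ x ∈ gradedPiece (Ideal.span (Set.range f)) 1,
      ∀ y ∈ gradedPiece (Ideal.span (Set.range f)) 1, x * y = 0 → y = 0 := by
  set I := Ideal.span (Set.range f)
  have hsyz := hreg.toIsWeaklyRegular.mem_span_of_sum_mul_eq_zero
  have : Nontrivial (Fin (n + 1)) := Fin.nontrivial_iff_two_le.2 (by omega)
  obtain ⟨b, hb, hb1, hlines⟩ := exists_finite_lines_of_sq_mem_span hf hreg.algebraicIndependent
  have : Module.Finite K (homogeneousSubmodule (Fin (n + 1)) K 1) :=
    Module.Finite.iff_fg.2 (homogeneousSubmodule_fg _ _ 1)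
  have : FiniteDimensional K (gradedPiece I 1) :=
    Module.Finite.map _ _
  have hmk : ∀ p : MvPolynomial (Fin (n + 1)) K, p.IsHomogeneous 1 → Ideal.Quotient.mk I p = 0 →
      p = 0 := fun p hp h =>
    eq_zero_of_mem_span_of_lt hf hp one_lt_two (Ideal.Quotient.eq_zero_iff_mem.1 h)
  have hX : ∀ p : MvPolynomial (Fin (n + 1)) K, (∀ v ∈ gradedPiece I 1,
      v * Ideal.Quotient.mk I p = 0) → ∀ i, X i * p ∈ I := fun p h i =>
    Ideal.Quotient.eq_zero_iff_mem.1 (by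
      rw [map_mul]
      exact h _ (mem_gradedPiece_iff.2 ⟨X i, isHomogeneous_X K i, rfl⟩))
  refine (gradedPiece I 1).exists_mul_injOn ?_ ?_ (Ideal.Quotient.mk I '' b) (hb.image _) ?_ ?_
  · rintro w hw h
    obtain ⟨w, hw1, rfl⟩ := mem_gradedPiece_iff.1 hw
    rw [eq_zero_of_X_mul_mem_span hf hsyz hw1 (hX w h), map_zero]
  · rintro y hy h
    obtain ⟨y, hy1, rfl⟩ := mem_gradedPiece_iff.1 hy
    rw [← map_mul] at h ⊢
    refine Ideal.Quotient.eq_zero_iff_mem.2 (mem_span_of_X_mul_mem_span hf hsyz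
      (i := ⟨0, by omega⟩) (k := ⟨1, by omega⟩) (p := ⟨2, by omega⟩) (by simp) (by simp) (by simp)
      (hy1.mul hy1) (hX _ h))
  · rintro _ ⟨w, hw, rfl⟩
    exact ⟨mem_gradedPiece_iff.2 ⟨w, (hb1 w hw).1, rfl⟩,
      fun h => (hb1 w hw).2 (hmk w (hb1 w hw).1 h)⟩
  · rintro y hy hy0 hyy
    obtain ⟨y, hy1, rfl⟩ := mem_gradedPiece_iff.1 hy
    rw [← map_mul, Ideal.Quotient.eq_zero_iff_mem, ← pow_two] at hyy
    obtain ⟨w, hw, c, rfl⟩ := hlines y hy1 (by rintro rfl; exact hy0 (map_zero _)) hyy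
    exact ⟨_, ⟨w, hw, rfl⟩, c, rfl⟩

end Quadrics

/-- **Weak Lefschetz in degree 1 for complete intersections of forms of equal degree.**
Let `S = K[x₀,…,x_n]` (char `K = 0`, algebraically closed) and let `I` be generated by a
regular sequence of `n + 1` homogeneous polynomials of degree `e ≥ 2`.  Then `R = S/I`
has the weak Lefschetz property in degree `1`: there is `x ∈ R¹` such that
`x· : R¹ → R²` has maximal rank (it is injective or surjective). -/
theorem wlp_degree_one_complete_intersection
    {K : Type*} [Field K] [IsAlgClosed K] [CharZero K]
    {n e : ℕ} (he : 2 ≤ e)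
    (f : Fin (n + 1) → MvPolynomial (Fin (n + 1)) K)
    (hf : ∀ i, (f i).IsHomogeneous e)
    (hreg : RingTheory.Sequence.IsRegular (MvPolynomial (Fin (n + 1)) K) (List.ofFn f))
    (I : Ideal (MvPolynomial (Fin (n + 1)) K)) (hI : I = Ideal.span (Set.range f)) :
    ∃ x ∈ gradedPiece I 1,
      (∀ y ∈ gradedPiece I 1, x * y = 0 → y = 0) ∨
      (∀ z ∈ gradedPiece I 2, ∃ y ∈ gradedPiece I 1, x * y = z) := by
  subst hI
  obtain rfl | he := he.eq_or_lt
  · obtain hn | hn := le_or_gt 2 n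
    · obtain ⟨x, hx, h⟩ := exists_mul_injOn_gradedPiece_one hn hf hreg
      exact ⟨x, hx, Or.inl h⟩
    · obtain ⟨x, hx, h⟩ := exists_mul_surjOn_gradedPiece_two (Nat.le_of_lt_succ hn) hf
        hreg.algebraicIndependent
      exact ⟨x, hx, Or.inr h⟩
  · refine ⟨_, mem_gradedPiece_iff.2 ⟨MvPolynomial.X 0, MvPolynomial.isHomogeneous_X K 0, rfl⟩,
      Or.inl fun y hy hxy => ?_⟩
    obtain ⟨y, hy1, rfl⟩ := mem_gradedPiece_iff.1 hy
    rw [← map_mul, Ideal.Quotient.eq_zero_iff_mem] at hxy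
    have h := MvPolynomial.eq_zero_of_mem_span_of_lt hf
      ((MvPolynomial.isHomogeneous_X K 0).mul hy1) he hxy
    rw [(mul_eq_zero.1 h).resolve_left (MvPolynomial.X_ne_zero 0), map_zero]
end

section
/- Let K be an algebraically closed field of characteristic 0, S = K[x₀,…,x₄], and let I ⊆ S be an ideal generated by a regular sequence of five homogeneous quadrics; set R = S/I. Let x ∈ R¹ and q ∈ R² be nonzero elements with q·x = 0, and let W ⊆ ker(·q : R² → R⁴) be a K-subspace with dim_K W ≥ 4. Then W ∩ (x·R¹) ≠ {0}. -/
section Graded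

open MvPolynomial

variable {σ K : Type*} [Field K]

attribute [local instance] MvPolynomial.gradedAlgebra

namespace MvPolynomial

lemma homogeneousComponent_mul_add {a : MvPolynomial σ K} {m : ℕ} (ha : a.IsHomogeneous m)
    (b : MvPolynomial σ K) (n : ℕ) :
    homogeneousComponent (m + n) (a * b) = a * homogeneousComponent n b := by
  have h := DirectSum.coe_decompose_mul_add_of_left_mem (homogeneousSubmodule σ K)
    (i := m) (j := n) (a := a) (b := b) ha
  rwa [← decomposition.decompose'_apply, ← decomposition.decompose'_apply]

lemma homogeneousComponent_mul_of_lt {a : MvPolynomial σ K} {m n : ℕ} (ha : a.IsHomogeneous m)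
    (b : MvPolynomial σ K) (h : n < m) : homogeneousComponent n (a * b) = 0 := by
  have h := DirectSum.coe_decompose_mul_of_left_mem_of_not_le (homogeneousSubmodule σ K)
    (i := m) (n := n) (a := a) (b := b) ha (by omega)
  rwa [← decomposition.decompose'_apply]

lemma mem_span_range_X_of_constantCoeff_eq_zero {p : MvPolynomial σ K}
    (hp : constantCoeff p = 0) : p ∈ Ideal.span (Set.range (X : σ → MvPolynomial σ K)) := by
  rw [← Set.image_univ, mem_ideal_span_X_image]
  intro m hm
  by_contra! h
  obtain rfl : m = 0 := Finsupp.ext fun i => h i trivial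
  exact mem_support_iff.mp hm hp

end MvPolynomial

/-- Multiplication by `g` is injective on `R ⧸ J`. -/
def IsRegularModulo {R : Type*} [CommRing R] (J : Ideal R) (g : R) : Prop :=
  ∀ a, g * a ∈ J → a ∈ J

/-- The entries of the list form a (weakly) regular sequence on `R ⧸ J`. -/
def IsRegularSeqModulo {R : Type*} [CommRing R] : Ideal R → List R → Prop
  | _, [] => True
  | J, g :: l => IsRegularModulo J g ∧ IsRegularSeqModulo (J ⊔ Ideal.span {g}) l

lemma isRegularSeqModulo_append_singleton {R : Type*} [CommRing R] (J : Ideal R) (l : List R)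
    (g : R) : IsRegularSeqModulo J (l ++ [g]) ↔
      IsRegularSeqModulo J l ∧ IsRegularModulo (J ⊔ Ideal.ofList l) g := by
  induction l generalizing J with
  | nil => simp [IsRegularSeqModulo]
  | cons a l ih => simp [IsRegularSeqModulo, ih, Ideal.ofList_cons, and_assoc, sup_assoc]

lemma isRegularSeqModulo_of_isWeaklyRegular {R : Type*} [CommRing R] (l : List R)
    (h : RingTheory.Sequence.IsWeaklyRegular R l) : IsRegularSeqModulo ⊥ l := by
  induction l using List.reverseRecOn with
  | nil => trivial
  | append_singleton l g ih =>
    rw [RingTheory.Sequence.isWeaklyRegular_append_iff,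
      RingTheory.Sequence.isWeaklyRegular_singleton_iff, smul_eq_mul, Ideal.mul_top,
      isSMulRegular_quotient_iff_mem_of_smul_mem] at h
    rw [isRegularSeqModulo_append_singleton, bot_sup_eq]
    exact ⟨ih h.1, h.2⟩

variable {J : Ideal (MvPolynomial σ K)} {a b g : MvPolynomial σ K} {m n : ℕ}

lemma Ideal.IsHomogeneous.sup_span_singleton (hJ : J.IsHomogeneous (homogeneousSubmodule σ K))
    (hg : g.IsHomogeneous n) :
    (J ⊔ Ideal.span {g}).IsHomogeneous (homogeneousSubmodule σ K) :=
  hJ.sup (Ideal.homogeneous_span _ _ fun x hx => ⟨n, by rwa [Set.mem_singleton_iff.mp hx]⟩)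

lemma IsRegularModulo.of_homogeneous (hJ : J.IsHomogeneous (homogeneousSubmodule σ K))
    (hg : g.IsHomogeneous n) (h : ∀ d a, a.IsHomogeneous d → g * a ∈ J → a ∈ J) :
    IsRegularModulo J g := by
  intro a ha
  rw [mem_iff_homogeneousComponent_mem hJ]
  intro d
  refine h d _ (homogeneousComponent_isHomogeneous d a) ?_
  rw [← homogeneousComponent_mul_add hg]
  exact homogeneousComponent_mem_of_mem hJ ha _

/-- In the graded setting, a regular sequence of length two may be permuted. -/
lemma IsRegularModulo.swap (hJ : J.IsHomogeneous (homogeneousSubmodule σ K))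
    (ha : a.IsHomogeneous m) (hm : 0 < m) (hb : b.IsHomogeneous n)
    (hJa : IsRegularModulo J a) (hJb : IsRegularModulo (J ⊔ Ideal.span {a}) b) :
    IsRegularModulo J b ∧ IsRegularModulo (J ⊔ Ideal.span {b}) a := by
  have hbJ : IsRegularModulo J b := by
    refine .of_homogeneous hJ hb fun d => ?_
    induction d using Nat.strong_induction_on with
    | _ d ih =>
      intro r hr hbr
      obtain ⟨j, hj, s, hs, hjs⟩ := Submodule.mem_sup.mp (hJb r (Ideal.mem_sup_left hbr))
      obtain ⟨t, rfl⟩ := Ideal.mem_span_singleton'.mp hs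
      have hrd : r = homogeneousComponent d j + homogeneousComponent d (a * t) := by
        rw [← map_add, mul_comm a, hjs, homogeneousComponent_eq_self hr]
      have hjd := homogeneousComponent_mem_of_mem hJ hj d
      rcases lt_or_ge d m with hd | hd
      · rw [hrd, homogeneousComponent_mul_of_lt ha _ hd, add_zero]
        exact hjd
      · obtain ⟨k, rfl⟩ := Nat.exists_eq_add_of_le hd
        rw [homogeneousComponent_mul_add ha] at hrd
        rw [hrd]
        refine J.add_mem hjd (J.mul_mem_left _ (ih k (by omega) _
          (homogeneousComponent_isHomogeneous k t) (hJa _ ?_)))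
        have : a * (b * homogeneousComponent k t)
            = b * r - b * homogeneousComponent (m + k) j := by rw [hrd]; ring
        rw [this]
        exact J.sub_mem hbr (J.mul_mem_left _ hjd)
  refine ⟨hbJ, fun r hr => ?_⟩
  obtain ⟨j, hj, s, hs, hjs⟩ := Submodule.mem_sup.mp hr
  obtain ⟨t, rfl⟩ := Ideal.mem_span_singleton'.mp hs
  obtain ⟨j', hj', s', hs', rfl⟩ := Submodule.mem_sup.mp
    (hJb t (Submodule.mem_sup.mpr ⟨-j, J.neg_mem hj, a * r,
      Ideal.mul_mem_right _ _ (Ideal.mem_span_singleton_self a), by rw [← hjs]; ring⟩))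
  obtain ⟨u, rfl⟩ := Ideal.mem_span_singleton'.mp hs'
  have : r - u * b ∈ J := hJa _ (by
    have : a * (r - u * b) = j + b * j' := by linear_combination -hjs
    rw [this]
    exact J.add_mem hj (J.mul_mem_left _ hj'))
  exact Submodule.mem_sup.mpr ⟨_, this, u * b, Ideal.mul_mem_left _ _
    (Ideal.mem_span_singleton_self b), by ring⟩

lemma IsRegularSeqModulo.move_to_front (hJ : J.IsHomogeneous (homogeneousSubmodule σ K))
    {l : List (MvPolynomial σ K)} (hl : ∀ g ∈ l, g.IsHomogeneous m) (hm : 0 < m)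
    (hb : b.IsHomogeneous n) (hseq : IsRegularSeqModulo J l)
    (hreg : IsRegularModulo (J ⊔ Ideal.ofList l) b) :
    IsRegularModulo J b ∧ IsRegularSeqModulo (J ⊔ Ideal.span {b}) l := by
  induction l generalizing J with
  | nil => exact ⟨by simpa using hreg, trivial⟩
  | cons a l ih =>
    have ha := hl a (by simp)
    rw [Ideal.ofList_cons, ← sup_assoc] at hreg
    obtain ⟨h₁, h₂⟩ := ih (hJ.sup_span_singleton ha) (fun g hg => hl g (by simp [hg])) hseq.2 hreg
    obtain ⟨h₃, h₄⟩ := IsRegularModulo.swap hJ ha hm hb hseq.1 h₁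
    exact ⟨h₃, h₄, by rwa [sup_right_comm]⟩

/-- Over an infinite field, if some positive degree form is regular modulo `J`, then so is
some linear form. -/
lemma IsRegularModulo.exists_linear [Finite σ] [Infinite K] (hg : IsRegularModulo J g)
    (hg0 : constantCoeff g = 0) : ∃ ℓ : MvPolynomial σ K, ℓ.IsHomogeneous 1 ∧
      IsRegularModulo J ℓ := by
  classical
  have hfin := associatedPrimes.finite (MvPolynomial σ K) (MvPolynomial σ K ⧸ J)
  let V := homogeneousSubmodule σ K 1
  let s : Finset (Subspace K V) := hfin.toFinset.image
    fun p => (p.restrictScalars K).comap V.subtype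
  have hs : ⊤ ∉ s := by
    intro h
    obtain ⟨p, hp, htop⟩ := Finset.mem_image.mp h
    rw [Set.Finite.mem_toFinset, AssociatedPrimes.mem_iff, isAssociatedPrime_iff] at hp
    obtain ⟨hprime, z, rfl⟩ := hp
    have hX : ∀ i, (X i : MvPolynomial σ K) ∈ (Submodule.colon ⊥ {z}) := fun i => by
      have : (⟨X i, isHomogeneous_X K i⟩ : V) ∈ (⊤ : Subspace K V) := trivial
      rw [← htop] at this
      exact this
    have hgp : g ∈ Submodule.colon ⊥ {z} := by
      exact Ideal.span_le.mpr (by rintro _ ⟨i, rfl⟩; exact hX i)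
        (mem_span_range_X_of_constantCoeff_eq_zero hg0)
    obtain ⟨z, rfl⟩ := Ideal.Quotient.mk_surjective z
    refine hprime.ne_top (Ideal.eq_top_iff_one _ |>.mpr ?_)
    rw [Submodule.mem_colon_singleton, Submodule.mem_bot] at hgp ⊢
    rw [one_smul, Ideal.Quotient.eq_zero_iff_mem]
    exact hg z (Ideal.Quotient.eq_zero_iff_mem.mp hgp)
  have := Subspace.biUnion_ne_univ_of_top_notMem hs
  obtain ⟨v, hv⟩ := (Set.ne_univ_iff_exists_notMem _).mp this
  refine ⟨v, v.2, fun a ha => ?_⟩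
  by_contra hna
  refine hv ?_
  have hmem : (v : MvPolynomial σ K) ∈ ⋃ p ∈ associatedPrimes (MvPolynomial σ K)
      (MvPolynomial σ K ⧸ J), (p : Set (MvPolynomial σ K)) := by
    rw [biUnion_associatedPrimes_eq_zero_divisors]
    exact ⟨Ideal.Quotient.mk J a, by rwa [Ne, Ideal.Quotient.eq_zero_iff_mem],
      (Ideal.Quotient.eq_zero_iff_mem (I := J)).mpr ha⟩
  simp only [Set.mem_iUnion] at hmem ⊢
  obtain ⟨p, hp, hvp⟩ := hmem
  exact ⟨_, Finset.mem_image.mpr ⟨p, by simpa using hp, rfl⟩, hvp⟩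

/-- The socle of `K[σ] ⧸ J` is concentrated in degree `e`. -/
def SocleInDegree (J : Ideal (MvPolynomial σ K)) (e : ℕ) : Prop :=
  ∀ d r, r.IsHomogeneous d → (∀ i, X i * r ∈ J) → r ∉ J → d = e

lemma SocleInDegree.exchange {ℓ : MvPolynomial σ K} {e : ℕ}
    (hJ : J.IsHomogeneous (homogeneousSubmodule σ K))
    (hℓ : ℓ.IsHomogeneous 1) (hg : g.IsHomogeneous 2)
    (hJℓ : IsRegularModulo J ℓ) (hJg : IsRegularModulo J g)
    (h : SocleInDegree (J ⊔ Ideal.span {ℓ}) e) : SocleInDegree (J ⊔ Ideal.span {g}) (e + 1) := by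
  intro d r hr hX hrJ
  have hker := mem_span_range_X_of_constantCoeff_eq_zero
    (show constantCoeff ℓ = 0 from hℓ.coeff_eq_zero (by simp))
  have hℓr : ℓ * r ∈ J ⊔ Ideal.span {g} := by
    have : Ideal.span (Set.range (X : σ → MvPolynomial σ K)) ≤
        (J ⊔ Ideal.span {g}).colon {r} := by
      rw [Ideal.span_le]
      rintro _ ⟨i, rfl⟩
      exact Submodule.mem_colon_singleton.mpr (hX i)
    exact Submodule.mem_colon_singleton.mp (this hker)
  obtain ⟨j, hj, s, hs, hjs⟩ := Submodule.mem_sup.mp hℓr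
  obtain ⟨t, rfl⟩ := Ideal.mem_span_singleton'.mp hs
  have hrℓ : (ℓ * r).IsHomogeneous (1 + d) := hℓ.mul hr
  have hcomp : ℓ * r = homogeneousComponent (1 + d) j + homogeneousComponent (1 + d) (g * t) := by
    rw [← map_add, mul_comm g, hjs, homogeneousComponent_eq_self hrℓ]
  have hjd := homogeneousComponent_mem_of_mem hJ hj (1 + d)
  rcases Nat.eq_zero_or_pos d with rfl | hd
  · rw [homogeneousComponent_mul_of_lt hg _ (by norm_num), add_zero] at hcomp
    exact absurd (Ideal.mem_sup_left (hJℓ r (hcomp ▸ hjd))) hrJ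
  obtain ⟨k, rfl⟩ := Nat.exists_eq_add_of_le' hd
  rw [show 1 + (k + 1) = 2 + k by ring, homogeneousComponent_mul_add hg] at hcomp
  rw [show 1 + (k + 1) = 2 + k by ring] at hjd
  set j' := homogeneousComponent (2 + k) j
  set s := homogeneousComponent k t
  congr 1
  refine h k s (homogeneousComponent_isHomogeneous k t) (fun i => ?_) fun hsJ => hrJ ?_
  · obtain ⟨j₁, hj₁, u, hu, hju⟩ := Submodule.mem_sup.mp (hX i)
    obtain ⟨u, rfl⟩ := Ideal.mem_span_singleton'.mp hu
    have : X i * s - u * ℓ ∈ J := hJg _ (by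
      have : g * (X i * s - u * ℓ) = ℓ * j₁ - X i * j' := by
        linear_combination -X i * hcomp - ℓ * hju
      rw [this]
      exact J.sub_mem (J.mul_mem_left _ hj₁) (J.mul_mem_left _ hjd))
    exact Submodule.mem_sup.mpr ⟨_, this, u * ℓ, Ideal.mul_mem_left _ _
      (Ideal.mem_span_singleton_self ℓ), by ring⟩
  · obtain ⟨j₁, hj₁, u, hu, hju⟩ := Submodule.mem_sup.mp hsJ
    obtain ⟨u, rfl⟩ := Ideal.mem_span_singleton'.mp hu
    have : r - u * g ∈ J := hJℓ _ (by
      have : ℓ * (r - u * g) = j' + g * j₁ := by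
        linear_combination hcomp - g * hju
      rw [this]
      exact J.add_mem hjd (J.mul_mem_left _ hj₁))
    exact Submodule.mem_sup.mpr ⟨_, this, u * g, Ideal.mul_mem_left _ _
      (Ideal.mem_span_singleton_self g), by ring⟩

/-- The degree `d` part of an ideal. -/
noncomputable def idealPiece (J : Ideal (MvPolynomial σ K)) (d : ℕ) :
    Submodule K (MvPolynomial σ K) :=
  homogeneousSubmodule σ K d ⊓ J.restrictScalars K

instance [Finite σ] (d : ℕ) : Module.Finite K (homogeneousSubmodule σ K d) :=
  Module.Finite.iff_fg.mpr (homogeneousSubmodule_fg σ K d)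

instance [Finite σ] (J : Ideal (MvPolynomial σ K)) (d : ℕ) : Module.Finite K (idealPiece J d) :=
  Submodule.finiteDimensional_inf_left _ _

open Module in
/-- A regular sequence of quadrics may be exchanged for linear forms, up to a shift of the
socle degree. -/
theorem exists_ideal_socleInDegree_add [Finite σ] [Infinite K]
    (hJ : J.IsHomogeneous (homogeneousSubmodule σ K))
    (hJ0 : J ≤ RingHom.ker constantCoeff) {l : List (MvPolynomial σ K)}
    (hl : ∀ g ∈ l, g.IsHomogeneous 2) (hseq : IsRegularSeqModulo J l) :
    ∃ L, J ≤ L ∧ finrank K (idealPiece J 1) + l.length ≤ finrank K (idealPiece L 1) ∧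
      ∀ e, SocleInDegree L e → SocleInDegree (J ⊔ Ideal.ofList l) (e + l.length) := by
  induction l using List.reverseRecOn generalizing J with
  | nil => exact ⟨J, le_rfl, by simp, fun e he => by simpa using he⟩
  | append_singleton l g ih =>
    rw [isRegularSeqModulo_append_singleton] at hseq
    have hg := hl g (by simp)
    have hl' : ∀ g ∈ l, g.IsHomogeneous 2 := fun a ha => hl a (by simp [ha])
    have hconst : ∀ {p : MvPolynomial σ K} {d : ℕ}, p.IsHomogeneous d → d ≠ 0 →
        constantCoeff p = 0 := fun hp hd => hp.coeff_eq_zero (by simpa using hd.symm)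
    obtain ⟨ℓ, hℓ, hℓreg⟩ := hseq.2.exists_linear (hconst hg two_ne_zero)
    obtain ⟨-, hseq'⟩ := hseq.1.move_to_front hJ hl' two_pos hℓ hℓreg
    obtain ⟨L, hL, hrank, hsoc⟩ := ih (hJ.sup_span_singleton hℓ)
      (sup_le hJ0 (by simpa [Ideal.span_le] using hconst hℓ one_ne_zero)) hl' hseq'
    have hJl0 : J ⊔ Ideal.ofList l ≤ RingHom.ker constantCoeff :=
      sup_le hJ0 (Ideal.span_le.mpr fun a ha => hconst (hl' a ha) two_ne_zero)
    have hℓJ : ℓ ∉ J ⊔ Ideal.ofList l := fun h => by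
      simpa using hJl0 (hℓreg 1 (by simpa using h))
    have hlt : idealPiece J 1 < idealPiece (J ⊔ Ideal.span {ℓ}) 1 := by
      refine lt_of_le_of_ne (inf_le_inf_left _ fun x hx => Ideal.mem_sup_left hx) fun heq => hℓJ ?_
      have : ℓ ∈ idealPiece (J ⊔ Ideal.span {ℓ}) 1 :=
        ⟨hℓ, Ideal.mem_sup_right (Ideal.mem_span_singleton_self ℓ)⟩
      rw [← heq] at this
      exact Ideal.mem_sup_left this.2
    have := Submodule.finrank_lt_finrank_of_lt hlt
    refine ⟨L, le_sup_left.trans hL, by simp; omega, fun e he => ?_⟩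
    have hJl : (J ⊔ Ideal.ofList l).IsHomogeneous (homogeneousSubmodule σ K) :=
      hJ.sup (Ideal.homogeneous_span _ _ fun a ha => ⟨2, hl' a ha⟩)
    have h := hsoc e he
    rw [sup_right_comm] at h
    have h' := h.exchange hJl hℓ hg hℓreg hseq.2
    simpa [Ideal.ofList_append, ← sup_assoc, ← add_assoc] using h'

lemma idealPiece_sup_span_singleton_of_lt {e d : ℕ}
    (hJ : J.IsHomogeneous (homogeneousSubmodule σ K)) (hg : g.IsHomogeneous e) (hd : d < e) :
    idealPiece (J ⊔ Ideal.span {g}) d = idealPiece J d := by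
  refine le_antisymm (fun p hp => ⟨hp.1, ?_⟩) (inf_le_inf_left _ fun x hx => Ideal.mem_sup_left hx)
  obtain ⟨j, hj, s, hs, hjs⟩ := Submodule.mem_sup.mp hp.2
  obtain ⟨t, rfl⟩ := Ideal.mem_span_singleton'.mp hs
  have h := homogeneousComponent_eq_self hp.1
  rw [← hjs, map_add, mul_comm, homogeneousComponent_mul_of_lt hg t hd, add_zero, mul_comm,
    hjs] at h
  exact h ▸ homogeneousComponent_mem_of_mem hJ hj d

open Module in
lemma finrank_idealPiece_sup_span_singleton [Finite σ] {e : ℕ}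
    (hJ : J.IsHomogeneous (homogeneousSubmodule σ K)) (hg : g.IsHomogeneous e) (hg0 : g ≠ 0)
    (hreg : IsRegularModulo J g) (d : ℕ) :
    finrank K (idealPiece (J ⊔ Ideal.span {g}) (e + d)) + finrank K (idealPiece J d) =
      finrank K (idealPiece J (e + d)) + finrank K (homogeneousSubmodule σ K d) := by
  have hinj : Function.Injective (LinearMap.mulLeft K g) := mul_right_injective₀ hg0
  have hsup : idealPiece (J ⊔ Ideal.span {g}) (e + d) = idealPiece J (e + d) ⊔
      (homogeneousSubmodule σ K d).map (LinearMap.mulLeft K g) := by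
    refine le_antisymm (fun p hp => ?_) (sup_le
      (inf_le_inf_left _ fun x hx => Ideal.mem_sup_left hx) ?_)
    · obtain ⟨j, hj, s, hs, hjs⟩ := Submodule.mem_sup.mp hp.2
      obtain ⟨t, rfl⟩ := Ideal.mem_span_singleton'.mp hs
      rw [← homogeneousComponent_eq_self hp.1, ← hjs, map_add, mul_comm,
        homogeneousComponent_mul_add hg]
      exact Submodule.add_mem_sup ⟨homogeneousComponent_mem _ _,
        homogeneousComponent_mem_of_mem hJ hj _⟩ ⟨_, homogeneousComponent_mem _ _, rfl⟩
    · rintro _ ⟨p, hp, rfl⟩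
      exact ⟨hg.mul hp, Ideal.mem_sup_right (Ideal.mul_mem_right _ _
        (Ideal.mem_span_singleton_self g))⟩
  have hinf : idealPiece J (e + d) ⊓ (homogeneousSubmodule σ K d).map (LinearMap.mulLeft K g) =
      (idealPiece J d).map (LinearMap.mulLeft K g) := by
    ext p
    constructor
    · rintro ⟨⟨-, hp⟩, t, ht, rfl⟩
      exact ⟨t, ⟨ht, hreg t hp⟩, rfl⟩
    · rintro ⟨t, ⟨ht, htJ⟩, rfl⟩
      exact ⟨⟨hg.mul ht, J.mul_mem_left _ htJ⟩, t, ht, rfl⟩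
  have h := Submodule.finrank_sup_add_finrank_inf_eq (idealPiece J (e + d))
    ((homogeneousSubmodule σ K d).map (LinearMap.mulLeft K g))
  rwa [← hsup, hinf, ← (Submodule.equivMapOfInjective _ hinj (idealPiece J d)).finrank_eq,
    ← (Submodule.equivMapOfInjective _ hinj (homogeneousSubmodule σ K d)).finrank_eq] at h

open Module in
/-- The Hilbert function of `K[σ] ⧸ J`. -/
noncomputable def hilbertFn (J : Ideal (MvPolynomial σ K)) (d : ℕ) : ℤ :=
  finrank K (homogeneousSubmodule σ K d) - finrank K (idealPiece J d)

/-- The effect on Hilbert functions of dividing by a regular quadric. -/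
def quadricDiff (h : ℕ → ℤ) : ℕ → ℤ
  | 0 => h 0
  | 1 => h 1
  | d + 2 => h (d + 2) - h d

lemma hilbertFn_sup_ofList [Finite σ] (hJ : J.IsHomogeneous (homogeneousSubmodule σ K))
    {l : List (MvPolynomial σ K)} (hl : ∀ g ∈ l, g.IsHomogeneous 2)
    (hseq : IsRegularSeqModulo J l) (hne : J ⊔ Ideal.ofList l ≠ ⊤) :
    hilbertFn (J ⊔ Ideal.ofList l) = quadricDiff^[l.length] (hilbertFn J) := by
  induction l generalizing J with
  | nil => simp
  | cons g l ih =>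
    have hg := hl g (by simp)
    rw [Ideal.ofList_cons, ← sup_assoc] at hne ⊢
    rw [ih (hJ.sup_span_singleton hg) (fun a ha => hl a (by simp [ha])) hseq.2 hne,
      List.length_cons, Function.iterate_succ_apply]
    congr 1
    have hg0 : g ≠ 0 := by
      rintro rfl
      refine hne (top_unique ?_)
      rw [(Ideal.eq_top_iff_one J).mpr (hseq.1 1 (by simp)), top_sup_eq, top_sup_eq]
    funext d
    match d with
    | 0 => rw [hilbertFn, idealPiece_sup_span_singleton_of_lt hJ hg two_pos]; rfl
    | 1 => rw [hilbertFn, idealPiece_sup_span_singleton_of_lt hJ hg one_lt_two]; rfl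
    | d + 2 =>
      have := finrank_idealPiece_sup_span_singleton hJ hg hg0 hseq.1 d
      rw [add_comm 2 d] at this
      simp only [hilbertFn, quadricDiff]
      omega

lemma finrank_homogeneousSubmodule [Fintype σ] (d : ℕ) :
    Module.finrank K (homogeneousSubmodule σ K d) = (Fintype.card σ + d - 1).choose d := by
  classical
  have hs : {m : σ →₀ ℕ | m.degree = d} =
      ((Finset.univ.finsuppAntidiag d : Finset (σ →₀ ℕ)) : Set (σ →₀ ℕ)) := by
    ext m
    simp [Finset.mem_finsuppAntidiag, Finsupp.degree_eq_sum]
  rw [homogeneousSubmodule_eq_finsupp_supported,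
    (AddMonoidAlgebra.supportedEquivFinsupp (R := K) (S := K) _).finrank_eq, hs,
    Module.finrank_finsupp_self, ← Nat.card_eq_fintype_card, Nat.card_coe_set_eq,
    Set.ncard_coe_finset, Finset.card_finsuppAntidiag_nat_eq_choose,
    Finset.card_univ]

end Graded

section Syzygies

open MvPolynomial

variable {σ K : Type*} [Field K]

attribute [local instance] MvPolynomial.gradedAlgebra

lemma idealPiece_sup_ofList_of_lt {J : Ideal (MvPolynomial σ K)} {l : List (MvPolynomial σ K)}
    {e d : ℕ} (hJ : J.IsHomogeneous (homogeneousSubmodule σ K))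
    (hl : ∀ g ∈ l, g.IsHomogeneous e) (hd : d < e) :
    idealPiece (J ⊔ Ideal.ofList l) d = idealPiece J d := by
  induction l generalizing J with
  | nil => simp
  | cons g l ih =>
    have hg := hl g (by simp)
    rw [Ideal.ofList_cons, ← sup_assoc, ih (hJ.sup_span_singleton hg)
      (fun a ha => hl a (by simp [ha])), idealPiece_sup_span_singleton_of_lt hJ hg hd]

/-- A regular sequence of quadrics has no linear syzygies. -/
lemma eq_zero_of_linear_syzygy {n : ℕ} {f c : Fin n → MvPolynomial σ K}
    (hf : ∀ i, (f i).IsHomogeneous 2) (hseq : IsRegularSeqModulo ⊥ (List.ofFn f))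
    (hc : ∀ i, (c i).IsHomogeneous 1) (h : ∑ i, c i * f i = 0) (i : Fin n) : c i = 0 := by
  induction n with
  | zero => exact i.elim0
  | succ n ih =>
    rw [List.ofFn_succ', List.concat_eq_append, isRegularSeqModulo_append_singleton] at hseq
    rw [Fin.sum_univ_castSucc] at h
    have hlast : c (Fin.last n) ∈ (⊥ ⊔ Ideal.ofList (List.ofFn fun i : Fin n => f i.castSucc)) := by
      refine hseq.2 _ ?_
      rw [mul_comm, eq_neg_of_add_eq_zero_right h]
      exact neg_mem (Ideal.mem_sup_right (sum_mem fun i _ => Ideal.mul_mem_left _ _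
        (Ideal.subset_span (List.mem_ofFn.mpr ⟨i, rfl⟩))))
    have hmem : c (Fin.last n) ∈
        idealPiece (⊥ ⊔ Ideal.ofList (List.ofFn fun i : Fin n => f i.castSucc)) 1 :=
      ⟨hc _, hlast⟩
    rw [idealPiece_sup_ofList_of_lt (Ideal.IsHomogeneous.bot _)
      (fun g hg => by obtain ⟨j, rfl⟩ := List.mem_ofFn.mp hg; exact hf _) one_lt_two] at hmem
    have hzero : c (Fin.last n) = 0 := hmem.2
    refine Fin.lastCases hzero (fun j => ?_) i
    refine ih (fun j => hf _) hseq.1 (fun j => hc _) ?_ j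
    simpa [hzero] using h

lemma exists_eq_sum_C_mul {n e : ℕ} {f : Fin n → MvPolynomial σ K}
    (hf : ∀ i, (f i).IsHomogeneous e) {p : MvPolynomial σ K} (hp : p.IsHomogeneous e)
    (hpf : p ∈ Ideal.span (Set.range f)) : ∃ c : Fin n → K, p = ∑ i, C (c i) * f i := by
  obtain ⟨a, rfl⟩ := Ideal.mem_span_range_iff_exists_fun.mp hpf
  refine ⟨fun i => coeff 0 (a i), ?_⟩
  conv_lhs => rw [← homogeneousComponent_eq_self hp, map_sum]
  refine Finset.sum_congr rfl fun i _ => ?_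
  rw [mul_comm, ← add_zero e, homogeneousComponent_mul_add (hf i), homogeneousComponent_zero,
    mul_comm]

end Syzygies

section LinearAlgebra

open Module

variable {K : Type*} [Field K]

lemma finrank_range_le_of_ker_pairing_le {V E F M : Type*} [AddCommGroup V] [Module K V]
    [AddCommGroup E] [Module K E] [AddCommGroup F] [Module K F] [AddCommGroup M] [Module K M]
    [FiniteDimensional K V] [FiniteDimensional K E] [FiniteDimensional K F]
    (Ψ : V →ₗ[K] E →ₗ[K] F) (μ : V →ₗ[K] M) (hker : LinearMap.ker Ψ ≤ LinearMap.ker μ)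
    (hF : finrank K F ≤ 1) : finrank K (LinearMap.range μ) ≤ finrank K E := by
  have h₁ := Ψ.finrank_range_add_finrank_ker
  have h₂ := μ.finrank_range_add_finrank_ker
  have h₃ := Submodule.finrank_mono hker
  have h₄ := (LinearMap.range Ψ).finrank_le
  rw [finrank_linearMap] at h₄
  have h₅ : finrank K E * finrank K F ≤ finrank K E * 1 := by gcongr
  omega

lemma exists_apply_eq_smul_apply [IsAlgClosed K] {E F : Type*} [AddCommGroup E] [Module K E]
    [AddCommGroup F] [Module K F] [FiniteDimensional K E] [FiniteDimensional K F] [Nontrivial E]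
    (hEF : finrank K E = finrank K F) {U : E →ₗ[K] F} (hU : Function.Injective U)
    (V : E →ₗ[K] F) : ∃ (c : K) (e : E), e ≠ 0 ∧ V e = c • U e := by
  let Ue := LinearEquiv.ofInjectiveOfFinrankEq U hU hEF
  obtain ⟨c, hc⟩ := Module.End.exists_eigenvalue (Ue.symm.toLinearMap ∘ₗ V)
  obtain ⟨e, he⟩ := hc.exists_hasEigenvector
  refine ⟨c, e, he.2, ?_⟩
  have heq : V e = Ue (c • e) := Ue.symm_apply_eq.mp he.apply_eq_smul
  rw [map_smul] at heq
  exact heq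

lemma exists_mul_eq_zero_of_finrank_eq [IsAlgClosed K] {A : Type*} [CommRing A] [Algebra K A]
    {E F : Submodule K A} [FiniteDimensional K E] [FiniteDimensional K F] [Nontrivial E]
    (hEF : finrank K E = finrank K F) {u v : A} (hu : ∀ e ∈ E, LinearMap.mulLeft K u e ∈ F)
    (hv : ∀ e ∈ E, LinearMap.mulLeft K v e ∈ F) :
    ∃ y, (y = u ∨ ∃ c : K, y = v - c • u) ∧ ∃ e ∈ E, e ≠ 0 ∧ y * e = 0 := by
  by_cases hU : Function.Injective ((LinearMap.mulLeft K u).restrict hu)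
  · obtain ⟨c, e, he0, heq⟩ :=
      exists_apply_eq_smul_apply hEF hU ((LinearMap.mulLeft K v).restrict hv)
    refine ⟨v - c • u, Or.inr ⟨c, rfl⟩, e, e.2, by simpa using he0, ?_⟩
    rw [sub_mul, smul_mul_assoc, sub_eq_zero]
    exact congrArg Subtype.val heq
  · obtain ⟨e, he, he0⟩ := (Submodule.ne_bot_iff _).mp (mt LinearMap.ker_eq_bot.mp hU)
    exact ⟨u, Or.inl rfl, e, e.2, by simpa using he0, congrArg Subtype.val he⟩

lemma finrank_map_add_finrank_inf_ker {A B : Type*} [AddCommGroup A] [Module K A]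
    [AddCommGroup B] [Module K B] (φ : A →ₗ[K] B) (N : Submodule K A) [FiniteDimensional K N] :
    finrank K (N.map φ) + finrank K (N ⊓ LinearMap.ker φ : Submodule K A) = finrank K N := by
  have h := (φ.domRestrict N).finrank_range_add_finrank_ker
  have hker : (LinearMap.ker (φ.domRestrict N)).map N.subtype = N ⊓ LinearMap.ker φ := by
    ext p
    simp [and_comm]
  rwa [LinearMap.range_domRestrict,
    (Submodule.equivMapOfInjective _ N.injective_subtype _).finrank_eq, hker] at h

lemma exists_eq_smul_of_finrank_le_one {M : Type*} [AddCommGroup M] [Module K M]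
    {E : Submodule K M} [FiniteDimensional K E] (hE : finrank K E ≤ 1) {e a : M} (he : e ∈ E)
    (he0 : e ≠ 0) (ha : a ∈ E) : ∃ c : K, a = c • e := by
  obtain ⟨v, hv⟩ := finrank_le_one_iff.mp hE
  obtain ⟨c, hc⟩ := hv ⟨a, ha⟩
  obtain ⟨d, hd⟩ := hv ⟨e, he⟩
  have hc' : c • (v : M) = a := congrArg Subtype.val hc
  have hd' : d • (v : M) = e := congrArg Subtype.val hd
  have hd0 : d ≠ 0 := by
    rintro rfl
    exact he0 (by rw [← hd', zero_smul])
  exact ⟨c * d⁻¹, by rw [← hc', ← hd', smul_smul, inv_mul_cancel_right₀ hd0]⟩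

/-- If `q` has rank at most two on `N`, then some nonzero `q y` has rank at most one on `G`. -/
lemma exists_mul_ne_zero_finrank_le_one [IsAlgClosed K] {A : Type*} [CommRing A] [Algebra K A]
    {G N : Submodule K A} [FiniteDimensional K G] [FiniteDimensional K N]
    (hGN : ∀ a ∈ G, ∀ b ∈ G, a * b ∈ N) {q u : A} (hu : u ∈ G) (hqu : q * u ≠ 0)
    (hle : finrank K (G.map (LinearMap.mulLeft K q)) ≤ finrank K (N.map (LinearMap.mulLeft K q)))
    (h2 : finrank K (N.map (LinearMap.mulLeft K q)) ≤ 2) :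
    ∃ y ∈ G, q * y ≠ 0 ∧ finrank K (G.map (LinearMap.mulLeft K (q * y))) ≤ 1 := by
  have hmap : ∀ y, G.map (LinearMap.mulLeft K (q * y)) =
      (G.map (LinearMap.mulLeft K q)).map (LinearMap.mulLeft K y) := by
    intro y
    rw [← Submodule.map_comp]
    congr 1
    ext a
    simp [mul_left_comm]
  suffices ∃ y ∈ G, q * y ≠ 0 ∧
      finrank K ((G.map (LinearMap.mulLeft K q)).map (LinearMap.mulLeft K y)) ≤ 1 by
    obtain ⟨y, hy, hqy, h⟩ := this
    exact ⟨y, hy, hqy, by rwa [hmap]⟩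
  have hmul : ∀ y ∈ G, ∀ e ∈ G.map (LinearMap.mulLeft K q),
      LinearMap.mulLeft K y e ∈ N.map (LinearMap.mulLeft K q) := by
    rintro y hy _ ⟨a, ha, rfl⟩
    exact ⟨y * a, hGN y hy a ha, by simp [mul_left_comm]⟩
  have hE : ∀ y ∈ G, q * y ∈ G.map (LinearMap.mulLeft K q) := fun y hy => ⟨y, hy, rfl⟩
  have hE' : ∀ e ∈ G.map (LinearMap.mulLeft K q), ∃ y ∈ G, q * y = e := fun e he => he
  have hEfin : FiniteDimensional K (G.map (LinearMap.mulLeft K q)) := inferInstance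
  have hFfin : FiniteDimensional K (N.map (LinearMap.mulLeft K q)) := inferInstance
  clear hmap
  generalize G.map (LinearMap.mulLeft K q) = E at *
  generalize N.map (LinearMap.mulLeft K q) = F at *
  rcases Nat.lt_or_ge (finrank K E) 2 with hlt | hge
  · exact ⟨u, hu, hqu, (Submodule.finrank_map_le _ _).trans (by omega)⟩
  have hEF : finrank K E = finrank K F := by omega
  suffices ∃ y ∈ G, q * y ≠ 0 ∧ ∃ e ∈ E, e ≠ 0 ∧ y * e = 0 by
    obtain ⟨y, hy, hqy, e, he, he0, hye⟩ := this
    refine ⟨y, hy, hqy, ?_⟩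
    have h := finrank_map_add_finrank_inf_ker (LinearMap.mulLeft K y) E
    have hne : E ⊓ LinearMap.ker (LinearMap.mulLeft K y) ≠ ⊥ :=
      (Submodule.ne_bot_iff _).mpr ⟨e, ⟨he, hye⟩, he0⟩
    have := Submodule.one_le_finrank_iff.mpr hne
    omega
  obtain ⟨v, hv, hqv⟩ : ∃ v ∈ G, ∀ c : K, q * v ≠ c • (q * u) := by
    by_contra! h
    have : finrank K E ≤ 1 := finrank_le_one ⟨q * u, hE u hu⟩ (by
      rintro ⟨w, hw⟩
      obtain ⟨v, hv, rfl⟩ := hE' w hw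
      obtain ⟨c, hc⟩ := h v hv
      exact ⟨c, Subtype.ext hc.symm⟩)
    omega
  have : Nontrivial E := (finrank_pos_iff (R := K)).mp (by omega)
  obtain ⟨y, rfl | ⟨c, rfl⟩, he⟩ :=
    exists_mul_eq_zero_of_finrank_eq hEF (hmul u hu) (hmul v hv)
  · exact ⟨y, hu, hqu, he⟩
  · refine ⟨v - c • u, G.sub_mem hv (G.smul_mem c hu), ?_, he⟩
    rw [mul_sub, mul_smul_comm, sub_ne_zero]
    exact hqv c

end LinearAlgebra

section GradedPiece

open MvPolynomial Module

variable {K : Type*} [Field K] {n : ℕ} {I : Ideal (MvPolynomial (Fin n) K)}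

instance (d : ℕ) : Module.Finite K (gradedPiece I d) := by
  unfold gradedPiece; infer_instance

lemma finrank_gradedPiece (I : Ideal (MvPolynomial (Fin n) K)) (d : ℕ) :
    (finrank K (gradedPiece I d) : ℤ) = hilbertFn I d := by
  have h := finrank_map_add_finrank_inf_ker (Ideal.Quotient.mkₐ K I).toLinearMap
    (homogeneousSubmodule (Fin n) K d)
  have hker : homogeneousSubmodule (Fin n) K d ⊓
      LinearMap.ker (Ideal.Quotient.mkₐ K I).toLinearMap = idealPiece I d := by
    ext p
    simp [idealPiece, Ideal.Quotient.eq_zero_iff_mem]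
  rw [hker] at h
  rw [hilbertFn, ← h, gradedPiece]
  push_cast
  ring

lemma mul_mem_gradedPiece {i j : ℕ} {a b : MvPolynomial (Fin n) K ⧸ I} (ha : a ∈ gradedPiece I i)
    (hb : b ∈ gradedPiece I j) : a * b ∈ gradedPiece I (i + j) := by
  obtain ⟨p, hp, rfl⟩ := ha
  obtain ⟨r, hr, rfl⟩ := hb
  exact ⟨p * r, hp.mul hr, map_mul (Ideal.Quotient.mkₐ K I) p r⟩

lemma mk_X_mem_gradedPiece (i : Fin n) : Ideal.Quotient.mk I (X i) ∈ gradedPiece I 1 :=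
  ⟨X i, isHomogeneous_X K i, rfl⟩

/-- If `w x_i x_j = p_i p_j ε` for all `i, j`, then `w g = g(p) ε` for every quadric `g`. -/
lemma mul_mk_quadric {w ε : MvPolynomial (Fin n) K ⧸ I} {p : Fin n → K}
    (h : ∀ i j, w * (Ideal.Quotient.mk I (X i) * Ideal.Quotient.mk I (X j)) = (p i * p j) • ε)
    {g : MvPolynomial (Fin n) K} (hg : g.IsHomogeneous 2) :
    w * Ideal.Quotient.mk I g = eval p g • ε := by
  have hg' : g ∈ homogeneousSubmodule (Fin n) K 2 := hg
  rw [← homogeneousSubmodule_one_pow, pow_two, homogeneousSubmodule_one_eq_span_X,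
    Submodule.span_mul_span] at hg'
  clear hg
  induction hg' using Submodule.span_induction with
  | mem x hx =>
    obtain ⟨_, ⟨i, rfl⟩, _, ⟨j, rfl⟩, rfl⟩ := Set.mem_mul.mp hx
    simpa using h i j
  | zero => simp
  | add x y _ _ hx hy => rw [map_add, mul_add, hx, hy, map_add, add_smul]
  | smul a x _ hx =>
    rw [← Ideal.Quotient.mkₐ_eq_mk K, map_smul, Ideal.Quotient.mkₐ_eq_mk, mul_smul_comm, hx,
      smul_eval, mul_smul]

variable {q : MvPolynomial (Fin n) K ⧸ I}

lemma eq_zero_of_forall_mul_linear {d s : ℕ} (hd : d ≠ s)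
    (hsoc : SocleInDegree I s) {r : MvPolynomial (Fin n) K ⧸ I}
    (hr : r ∈ gradedPiece I d) (h : ∀ y ∈ gradedPiece I 1, r * y = 0) : r = 0 := by
  obtain ⟨p, hp, rfl⟩ := hr
  by_contra hne
  refine hd (hsoc d p hp (fun i => ?_) fun hpI => hne (Ideal.Quotient.eq_zero_iff_mem.mpr hpI))
  rw [← Ideal.Quotient.eq_zero_iff_mem, mul_comm, map_mul]
  exact h _ (mk_X_mem_gradedPiece i)

/-- Multiplication by `q` has at least as large a rank on quadrics as on linear forms. -/
lemma finrank_mul_linear_le (hsoc : SocleInDegree I 5) (h5 : finrank K (gradedPiece I 5) ≤ 1)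
    (hq : q ∈ gradedPiece I 2) :
    finrank K ((gradedPiece I 1).map (LinearMap.mulLeft K q)) ≤
      finrank K ((gradedPiece I 2).map (LinearMap.mulLeft K q)) := by
  set E := (gradedPiece I 2).map (LinearMap.mulLeft K q) with hE
  have hmem : ∀ (y : gradedPiece I 1) (w : E), (y : MvPolynomial (Fin n) K ⧸ I) * w ∈
      gradedPiece I 5 := by
    rintro ⟨y, hy⟩ ⟨_, v, hv, rfl⟩
    exact mul_mem_gradedPiece (i := 1) (j := 4) hy (mul_mem_gradedPiece (i := 2) (j := 2) hq hv)
  let Ψ : gradedPiece I 1 →ₗ[K] E →ₗ[K] gradedPiece I 5 := LinearMap.mk₂ K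
    (fun y w => ⟨y * w, hmem y w⟩) (fun _ _ _ => Subtype.ext (add_mul _ _ _))
    (fun _ _ _ => Subtype.ext (smul_mul_assoc _ _ _)) (fun _ _ _ => Subtype.ext (mul_add _ _ _))
    (fun _ _ _ => Subtype.ext (mul_smul_comm _ _ _))
  let μ := (LinearMap.mulLeft K q).domRestrict (gradedPiece I 1)
  have hker : LinearMap.ker Ψ ≤ LinearMap.ker μ := by
    intro y hy
    have hy' : ∀ v ∈ gradedPiece I 2, q * y * v = 0 := fun v hv => by
      have := congrArg Subtype.val
        (LinearMap.congr_fun (LinearMap.mem_ker.mp hy) ⟨q * v, v, hv, rfl⟩)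
      simpa [Ψ, mul_left_comm, mul_assoc, mul_comm] using this
    have hqy : q * y ∈ gradedPiece I 3 := mul_mem_gradedPiece (i := 2) (j := 1) hq y.2
    refine eq_zero_of_forall_mul_linear (by norm_num) hsoc hqy fun a ha => ?_
    refine eq_zero_of_forall_mul_linear (by norm_num) hsoc
      (mul_mem_gradedPiece (i := 3) (j := 1) hqy ha) fun b hb => ?_
    rw [mul_assoc]
    exact hy' _ (mul_mem_gradedPiece (i := 1) (j := 1) ha hb)
  have h := finrank_range_le_of_ker_pairing_le Ψ μ hker h5
  rwa [LinearMap.range_domRestrict] at h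

/-- If the quadrics in `I` have no common projective zero, then multiplication by a nonzero
`q` has rank at least three on quadrics. -/
lemma three_le_finrank_mul_quadrics [IsAlgClosed K] (hsoc : SocleInDegree I 5)
    (h5 : finrank K (gradedPiece I 5) ≤ 1)
    (hzero : ∀ p : Fin n → K, (∀ g ∈ I, g.IsHomogeneous 2 → eval p g = 0) → p = 0)
    (hq : q ∈ gradedPiece I 2) (hq0 : q ≠ 0) :
    3 ≤ finrank K ((gradedPiece I 2).map (LinearMap.mulLeft K q)) := by
  by_contra! hlt
  obtain ⟨u, hu, hqu⟩ : ∃ u ∈ gradedPiece I 1, q * u ≠ 0 := by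
    by_contra! h
    exact hq0 (eq_zero_of_forall_mul_linear (by norm_num) hsoc hq h)
  have hle := finrank_mul_linear_le hsoc h5 hq
  have h2 : finrank K ((gradedPiece I 2).map (LinearMap.mulLeft K q)) ≤ 2 := by omega
  have hGN : ∀ a ∈ gradedPiece I 1, ∀ b ∈ gradedPiece I 1, a * b ∈ gradedPiece I 2 :=
    fun a ha b hb => mul_mem_gradedPiece (i := 1) (j := 1) ha hb
  obtain ⟨y, hy, hqy, hrank⟩ := exists_mul_ne_zero_finrank_le_one hGN hu hqu hle h2
  have hqy3 : q * y ∈ gradedPiece I 3 := mul_mem_gradedPiece (i := 2) (j := 1) hq hy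
  obtain ⟨z, hz, hqyz⟩ : ∃ z ∈ gradedPiece I 1, q * y * z ≠ 0 := by
    by_contra! h
    exact hqy (eq_zero_of_forall_mul_linear (by norm_num) hsoc hqy3 h)
  have hsmul : ∀ a ∈ gradedPiece I 1, ∃ c : K, q * y * a = c • (q * y * z) :=
    fun a ha => exists_eq_smul_of_finrank_le_one hrank ⟨z, hz, rfl⟩ hqyz ⟨a, ha, rfl⟩
  choose p hp using fun i => hsmul _ (mk_X_mem_gradedPiece (I := I) i)
  have hε : ∀ i, q * y * z * Ideal.Quotient.mk I (X i) = p i • (q * y * z * z) := fun i => by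
    rw [mul_right_comm, hp, smul_mul_assoc]
  have hε0 : q * y * z * z ≠ 0 := fun h0 => by
    refine hqyz (eq_zero_of_forall_mul_linear (d := 4) (by norm_num) hsoc
      (mul_mem_gradedPiece (i := 3) (j := 1) hqy3 hz) fun a ha => ?_)
    obtain ⟨c, hc⟩ := hsmul a ha
    rw [mul_right_comm, hc, smul_mul_assoc, h0, smul_zero]
  have hp0 : p = 0 := by
    refine hzero p fun g hg hg2 => ?_
    have := mul_mk_quadric (I := I) (w := q * y) (ε := q * y * z * z) (p := p)
      (fun i j => by rw [← mul_assoc, hp, smul_mul_assoc, hε, smul_smul]) hg2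
    rw [Ideal.Quotient.eq_zero_iff_mem.mpr hg, mul_zero] at this
    exact (smul_eq_zero.mp this.symm).resolve_right hε0
  obtain ⟨r, hr, hrq⟩ := hqy3
  refine hqy ?_
  rw [← hrq]
  by_contra hne
  have := hsoc 3 r hr (fun i => ?_) fun hrI => hne (Ideal.Quotient.eq_zero_iff_mem.mpr hrI)
  · norm_num at this
  · rw [← Ideal.Quotient.eq_zero_iff_mem, mul_comm, map_mul]
    have := hp i
    rw [hp0, Pi.zero_apply, zero_smul, ← hrq] at this
    exact this

end GradedPiece

section CompleteIntersection

open MvPolynomial Module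

attribute [local instance] MvPolynomial.gradedAlgebra

variable {σ K : Type*} [Field K]

lemma hilbertFn_bot [Fintype σ] (d : ℕ) :
    hilbertFn (⊥ : Ideal (MvPolynomial σ K)) d = ((Fintype.card σ + d - 1).choose d : ℕ) := by
  have h : idealPiece (⊥ : Ideal (MvPolynomial σ K)) d = ⊥ := by simp [idealPiece]
  rw [hilbertFn, h, finrank_bot, finrank_homogeneousSubmodule, Nat.cast_zero, sub_zero]

variable {l : List (MvPolynomial σ K)}

lemma ofList_le_ker_constantCoeff (hl : ∀ g ∈ l, g.IsHomogeneous 2) :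
    Ideal.ofList l ≤ RingHom.ker (constantCoeff : MvPolynomial σ K →+* K) :=
  Ideal.span_le.mpr fun g hg => (hl g hg).coeff_eq_zero (by simp)

lemma hilbertFn_ofList [Fintype σ] (hl : ∀ g ∈ l, g.IsHomogeneous 2)
    (hseq : IsRegularSeqModulo ⊥ l) : hilbertFn (Ideal.ofList l) =
      quadricDiff^[l.length] fun d => ((Fintype.card σ + d - 1).choose d : ℕ) := by
  have hne : (⊥ ⊔ Ideal.ofList l : Ideal (MvPolynomial σ K)) ≠ ⊤ := by
    rw [bot_sup_eq]
    exact ne_top_of_le_ne_top (RingHom.ker_ne_top _) (ofList_le_ker_constantCoeff hl)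
  have h := hilbertFn_sup_ofList (Ideal.IsHomogeneous.bot _) hl hseq hne
  rwa [bot_sup_eq, funext hilbertFn_bot] at h

/-- A regular sequence of `n` quadrics in `n` variables has its socle in degree `n`. -/
lemma socleInDegree_ofList [Fintype σ] [Infinite K] (hl : ∀ g ∈ l, g.IsHomogeneous 2)
    (hseq : IsRegularSeqModulo ⊥ l) (hlen : l.length = Fintype.card σ) :
    SocleInDegree (Ideal.ofList l) l.length := by
  obtain ⟨L, -, hrank, hsoc⟩ :=
    exists_ideal_socleInDegree_add (Ideal.IsHomogeneous.bot _) bot_le hl hseq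
  have hV : finrank K (homogeneousSubmodule σ K 1) = Fintype.card σ := by
    simp [finrank_homogeneousSubmodule]
  have hL : idealPiece L 1 = homogeneousSubmodule σ K 1 :=
    Submodule.eq_of_le_of_finrank_le inf_le_left (by omega)
  have hX : Ideal.span (Set.range X) ≤ L := by
    rw [Ideal.span_le]
    rintro _ ⟨i, rfl⟩
    have : X i ∈ idealPiece L 1 := hL ▸ isHomogeneous_X K i
    exact this.2
  have h := hsoc 0 fun d r hr _ hrL => by
    by_contra hd
    exact hrL (hX (mem_span_range_X_of_constantCoeff_eq_zero
      (hr.coeff_eq_zero (by simpa using Ne.symm hd))))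
  rwa [bot_sup_eq, zero_add] at h

variable {n : ℕ} {I : Ideal (MvPolynomial (Fin n) K)} {f : Fin n → MvPolynomial (Fin n) K}

lemma finrank_gradedPiece_inf_ker_mulLeft_le_one (hf : ∀ i, (f i).IsHomogeneous 2)
    (hseq : IsRegularSeqModulo ⊥ (List.ofFn f)) (hI : I = Ideal.span (Set.range f))
    {x : MvPolynomial (Fin n) K ⧸ I} (hx : x ∈ gradedPiece I 1) (hx0 : x ≠ 0) :
    finrank K (gradedPiece I 1 ⊓ LinearMap.ker (LinearMap.mulLeft K x) :
      Submodule K (MvPolynomial (Fin n) K ⧸ I)) ≤ 1 := by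
  obtain ⟨p, hp, rfl⟩ := hx
  have hrel : ∀ r : MvPolynomial (Fin n) K, r.IsHomogeneous 1 →
      Ideal.Quotient.mk I p * Ideal.Quotient.mk I r = 0 →
        ∃ c : Fin n → K, p * r = ∑ i, C (c i) * f i := fun r hr h => by
    rw [← map_mul, Ideal.Quotient.eq_zero_iff_mem, hI] at h
    exact exists_eq_sum_C_mul hf (IsHomogeneous.mul hp hr) h
  by_cases hbot : (gradedPiece I 1 ⊓ LinearMap.ker (LinearMap.mulLeft K (Ideal.Quotient.mk I p)) :
      Submodule K (MvPolynomial (Fin n) K ⧸ I)) = ⊥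
  · exact (congrArg (fun N : Submodule K (MvPolynomial (Fin n) K ⧸ I) => finrank K N)
      hbot).le.trans (by simp)
  obtain ⟨_, ⟨⟨r, hr, rfl⟩, hpr⟩, hr0⟩ := (Submodule.ne_bot_iff _).mp hbot
  obtain ⟨c, hc⟩ := hrel r hr hpr
  obtain ⟨i, hi⟩ : ∃ i, c i ≠ 0 := by
    by_contra! h
    have hmul : p * r = 0 := by simp [hc, h]
    rcases mul_eq_zero.mp hmul with rfl | rfl
    · exact hx0 (map_zero _)
    · exact hr0 (map_zero _)
  refine finrank_le_one ⟨_, ⟨⟨r, hr, rfl⟩, hpr⟩⟩ ?_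
  rintro ⟨_, ⟨s, hs, rfl⟩, hps⟩
  obtain ⟨d, hd⟩ := hrel s hs hps
  refine ⟨(c i)⁻¹ * d i, Subtype.ext ?_⟩
  have hsyz := eq_zero_of_linear_syzygy hf hseq (c := fun j => C (c j) * s - C (d j) * r)
    (fun j => by
      refine IsHomogeneous.sub ?_ ?_
      · simpa using (isHomogeneous_C (Fin n) (c j)).mul hs
      · simpa using (isHomogeneous_C (Fin n) (d j)).mul hr) (by
      simp only [sub_mul, Finset.sum_sub_distrib]
      have h₁ : ∑ j, C (c j) * s * f j = p * r * s := by
        rw [hc, Finset.sum_mul]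
        exact Finset.sum_congr rfl fun j _ => by ring
      have h₂ : ∑ j, C (d j) * r * f j = p * s * r := by
        rw [hd, Finset.sum_mul]
        exact Finset.sum_congr rfl fun j _ => by ring
      rw [h₁, h₂]
      ring) i
  have hs : s = ((c i)⁻¹ * d i) • r := by
    rw [mul_smul, smul_eq_C_mul (a := d i), ← sub_eq_zero.mp hsyz, ← smul_eq_C_mul,
      inv_smul_smul₀ hi]
  have := congrArg (Ideal.Quotient.mkₐ K I).toLinearMap hs
  rw [map_smul] at this
  exact this.symm

/-- If the degree `m` part of the quotient vanishes, the quadrics have no common zero. -/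
lemma eq_zero_of_forall_eval_eq_zero {m : ℕ} (hI : I = Ideal.span (Set.range f))
    (hm : hilbertFn I m = 0) {p : Fin n → K} (hp : ∀ i, eval p (f i) = 0) : p = 0 := by
  have hle : I ≤ RingHom.ker (eval p) := by
    rw [hI, Ideal.span_le]
    rintro _ ⟨i, rfl⟩
    exact hp i
  have hpiece : idealPiece I m = homogeneousSubmodule (Fin n) K m :=
    Submodule.eq_of_le_of_finrank_le inf_le_left (by rw [hilbertFn] at hm; omega)
  funext i
  have hX : X i ^ m ∈ idealPiece I m := hpiece ▸ by simpa using (isHomogeneous_X K i).pow m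
  have := hle hX.2
  rw [RingHom.mem_ker, map_pow, eval_X] at this
  exact eq_zero_of_pow_eq_zero this

end CompleteIntersection

/-- **Technical proposition.** Let `S = K[x₀,…,x₄]` (char `K = 0`, algebraically closed)
and let `I` be generated by a regular sequence of five homogeneous quadrics; `R = S/I`.
Let `x ∈ R¹`, `q ∈ R²` be nonzero with `q·x = 0`, and let `W ⊆ ker(·q : R² → R⁴)` be a
subspace with `dim_K W ≥ 4`.  Then `W ∩ (x·R¹) ≠ {0}`. -/
theorem subspace_meets_x_mul_R1
    {K : Type*} [Field K] [IsAlgClosed K] [CharZero K]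
    (f : Fin 5 → MvPolynomial (Fin 5) K)
    (hf : ∀ i, (f i).IsHomogeneous 2)
    (hreg : RingTheory.Sequence.IsRegular (MvPolynomial (Fin 5) K) (List.ofFn f))
    (I : Ideal (MvPolynomial (Fin 5) K)) (hI : I = Ideal.span (Set.range f))
    {x q : MvPolynomial (Fin 5) K ⧸ I}
    (hx : x ∈ gradedPiece I 1) (hx0 : x ≠ 0)
    (hq : q ∈ gradedPiece I 2) (hq0 : q ≠ 0)
    (hqx : q * x = 0)
    (W : Submodule K (MvPolynomial (Fin 5) K ⧸ I))
    (hW : W ≤ gradedPiece I 2 ⊓ LinearMap.ker (LinearMap.mulLeft K q))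
    (hdimW : 4 ≤ Module.finrank K W) :
    W ⊓ Submodule.map (LinearMap.mulLeft K x) (gradedPiece I 1) ≠ ⊥ := by
  have hl : ∀ g ∈ List.ofFn f, g.IsHomogeneous 2 := by
    rintro g hg
    obtain ⟨i, rfl⟩ := List.mem_ofFn.mp hg
    exact hf i
  have hseq := isRegularSeqModulo_of_isWeaklyRegular _ hreg.toIsWeaklyRegular
  have hIl : I = Ideal.ofList (List.ofFn f) := by
    rw [hI]
    congr 1
    ext g
    exact List.mem_ofFn.symm
  have hsoc : SocleInDegree I 5 := by
    have h := socleInDegree_ofList hl hseq (by simp)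
    rwa [← hIl, List.length_ofFn] at h
  have hilb : hilbertFn I = quadricDiff^[5] fun d => ((5 + d - 1).choose d : ℕ) := by
    have h := hilbertFn_ofList hl hseq
    rwa [← hIl, List.length_ofFn, Fintype.card_fin] at h
  have hval : hilbertFn I 1 = 5 ∧ hilbertFn I 2 = 10 ∧ hilbertFn I 5 = 1 ∧ hilbertFn I 6 = 0 := by
    rw [hilb]
    decide
  obtain ⟨h1, h2, h5, h6⟩ := hval
  rw [← finrank_gradedPiece] at h1 h2 h5
  have hq3 := three_le_finrank_mul_quadrics hsoc (by omega)
    (fun p hp => eq_zero_of_forall_eval_eq_zero hI h6 fun i =>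
      hp (f i) (hI ▸ Ideal.subset_span ⟨i, rfl⟩) (hf i)) hq hq0
  have hkerq := finrank_map_add_finrank_inf_ker (LinearMap.mulLeft K q) (gradedPiece I 2)
  have hkerx := finrank_map_add_finrank_inf_ker (LinearMap.mulLeft K x) (gradedPiece I 1)
  have hx1 := finrank_gradedPiece_inf_ker_mulLeft_le_one hf hseq hI hx hx0
  have hxR : (gradedPiece I 1).map (LinearMap.mulLeft K x) ≤
      gradedPiece I 2 ⊓ LinearMap.ker (LinearMap.mulLeft K q) := by
    rintro _ ⟨v, hv, rfl⟩
    have hqxv : q * (x * v) = 0 := by rw [← mul_assoc, hqx, zero_mul]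
    exact ⟨mul_mem_gradedPiece (i := 1) (j := 1) hx hv, hqxv⟩
  have : FiniteDimensional K W := Module.finite_of_finrank_pos (by omega)
  have : FiniteDimensional K (gradedPiece I 2 ⊓ LinearMap.ker (LinearMap.mulLeft K q) :
      Submodule K (MvPolynomial (Fin 5) K ⧸ I)) := Submodule.finiteDimensional_inf_left _ _
  have hsup := Submodule.finrank_mono (sup_le hW hxR)
  have hadd := Submodule.finrank_sup_add_finrank_inf_eq W
    ((gradedPiece I 1).map (LinearMap.mulLeft K x))
  intro hbot
  rw [hbot, finrank_bot] at hadd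
  omega
end

section
/- Let K be a field of characteristic 0 and let G ∈ K[x₀,…,x_m] be homogeneous of degree d ≥ 2. For k₀,…,k_m ∈ K set L = Σᵢ kᵢ ∂/∂xᵢ. Then for all indices 0 ≤ i, j ≤ m, applying the operator L^{d−2}∂ᵢ∂ⱼ to G yields the constant (d−2)! · (∂²G/∂xᵢ∂xⱼ)(k₀,…,k_m); equivalently, the matrix [(L^{d−2}∂ᵢ∂ⱼ)(G)]_{i,j} equals (d−2)! times the Hessian matrix Hess(G) evaluated at the point (k₀,…,k_m). -/
namespace MvPolynomial

variable {σ R : Type*} [Fintype σ] [CommSemiring R]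

/-- The directional derivative in the constant direction `k`, iterated `n` times on a form of
degree `n`, gives `n!` times the value of the form at `k`. -/
theorem IsHomogeneous.sum_smul_pderiv_pow_apply {n : ℕ} {F : MvPolynomial σ R}
    (hF : F.IsHomogeneous n) (k : σ → R) :
    ((∑ l, k l • (pderiv l).toLinearMap : Module.End R (MvPolynomial σ R)) ^ n) F =
      C ((n.factorial : R) * eval k F) := by
  induction n generalizing F with
  | zero =>
    obtain ⟨c, rfl⟩ : ∃ c, F = C c :=
      ⟨_, totalDegree_eq_zero_iff_eq_C.1 (Nat.le_zero.1 hF.totalDegree_le)⟩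
    simp
  | succ n ih =>
    have happly : (∑ l, k l • (pderiv l).toLinearMap : Module.End R (MvPolynomial σ R)) F =
        ∑ l, k l • pderiv l F := by
      simp [LinearMap.sum_apply]
    have hhom : (∑ l, k l • pderiv l F).IsHomogeneous n :=
      (homogeneousSubmodule σ R n).sum_mem fun l _ =>
        (homogeneousSubmodule σ R n).smul_mem _ hF.pderiv
    have heuler : eval k (∑ l, k l • pderiv l F) = ((n + 1 : ℕ) : R) * eval k F := by
      simpa [smul_eval] using congrArg (eval k) hF.sum_X_mul_pderiv
    rw [pow_succ, Module.End.mul_apply, happly, ih hhom, heuler, Nat.factorial_succ,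
      Nat.cast_mul, mul_left_comm, mul_assoc]

end MvPolynomial


/-- **Differential Euler identity for the Hessian.** For `G` homogeneous of degree `d ≥ 2`
over a field of characteristic `0` and `L = Σ kᵢ ∂ᵢ`, applying `L^(d-2) ∂ᵢ ∂ⱼ` to `G`
yields the constant polynomial `(d-2)! · (∂²G/∂xᵢ∂xⱼ)(k₀,…,k_m)`, i.e. `(d-2)!` times the
`(i,j)` entry of the Hessian matrix of `G` evaluated at `(k₀,…,k_m)`. -/
theorem pow_smul_pderiv_apply_eq_factorial_hessian_eval
    {K : Type*} [Field K] [CharZero K]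
    {m : ℕ} {d : ℕ} (hd : 2 ≤ d)
    {G : MvPolynomial (Fin (m + 1)) K} (hG : G.IsHomogeneous d)
    (k : Fin (m + 1) → K) :
    ∀ i j : Fin (m + 1),
      (((∑ l, k l • (MvPolynomial.pderiv l).toLinearMap :
            Module.End K (MvPolynomial (Fin (m + 1)) K)) ^ (d - 2) :
          Module.End K (MvPolynomial (Fin (m + 1)) K)) :
          MvPolynomial (Fin (m + 1)) K →ₗ[K] MvPolynomial (Fin (m + 1)) K)
        (MvPolynomial.pderiv i (MvPolynomial.pderiv j G)) =
      MvPolynomial.C (((d - 2).factorial : K) *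
        MvPolynomial.eval k
          ((Matrix.of fun i j : Fin (m + 1) =>
              MvPolynomial.pderiv i (MvPolynomial.pderiv j G)) i j)) := by
  intro i j
  have h : (MvPolynomial.pderiv i (MvPolynomial.pderiv j G)).IsHomogeneous (d - 2) :=
    hG.pderiv.pderiv
  exact h.sum_smul_pderiv_pow_apply k
end
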